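/- For every integer k with 0 ≤ k ≤ b, the Foulkes–Howe map α is injective in degree k: if P ∈ S is homogeneous of degree k and α(P) = 0, then P = 0. (Theorem 1.2, injectivity part.) -/

import Mathlib

open MvPolynomial

/-- The generic binary form `G = ∑_{i=0}^{b} u_i x^i y^{b-i}` of degree `b`,
viewed as a polynomial in two variables `x = X 0`, `y = X 1` with coefficients in
`R = MvPolynomial (Fin (b+1)) ℂ`. -/
noncomputable def genForm (b : ℕ) : MvPolynomial (Fin 2) (MvPolynomial (Fin (b + 1)) ℂ) :=
  ∑ i : Fin (b + 1),
    MvPolynomial.C (MvPolynomial.X i) *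
      MvPolynomial.X (0 : Fin 2) ^ (i : ℕ) * MvPolynomial.X (1 : Fin 2) ^ (b - (i : ℕ))

/-- The coefficient `c_j ∈ R` of `x^j y^{ab-j}` in `G^a`. -/
noncomputable def coeffC (a b j : ℕ) : MvPolynomial (Fin (b + 1)) ℂ :=
  MvPolynomial.coeff
    (Finsupp.single (0 : Fin 2) j + Finsupp.single (1 : Fin 2) (a * b - j))
    (genForm b ^ a)

/-- The Foulkes–Howe homomorphism `α : S → R`, `z_j ↦ c_j`. -/
noncomputable def FH (a b : ℕ) :
    MvPolynomial (Fin (a * b + 1)) ℂ →ₐ[ℂ] MvPolynomial (Fin (b + 1)) ℂ :=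
  MvPolynomial.aeval fun j : Fin (a * b + 1) => coeffC a b (j : ℕ)

namespace FoulkesHowe

theorem finSuccEquiv_pderiv_zero {m : ℕ} (f : MvPolynomial (Fin (m + 1)) ℂ) :
    finSuccEquiv ℂ m (pderiv 0 f) = Polynomial.derivative (finSuccEquiv ℂ m f) := by
  induction f using MvPolynomial.induction_on with
  | C r => simp [finSuccEquiv_apply]
  | add p q hp hq => simp [hp, hq]
  | mul_X p i hp =>
    refine Fin.cases ?_ (fun j => ?_) i
    · simp [hp, finSuccEquiv_X_zero, pderiv_X]; ring
    · simp [hp, finSuccEquiv_X_succ, pderiv_X, (Fin.succ_ne_zero j)]; ring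

theorem coeff_finSuccEquiv_pderiv_succ {m : ℕ} (f : MvPolynomial (Fin (m + 1)) ℂ) (j : Fin m)
    (t : ℕ) : (finSuccEquiv ℂ m (pderiv j.succ f)).coeff t =
      pderiv j ((finSuccEquiv ℂ m f).coeff t) := by
  ext s
  simp only [finSuccEquiv_coeff_coeff, coeff_pderiv]
  congr 2
  · ext i
    refine Fin.cases ?_ (fun i => ?_) i
    · simp [(Fin.succ_ne_zero j)]
    · simp [Finsupp.single_apply]

/-- The sum of all partial derivatives. -/
noncomputable def lowering {m : ℕ} : MvPolynomial (Fin m) ℂ →ₗ[ℂ] MvPolynomial (Fin m) ℂ :=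
  ∑ i, (pderiv i).toLinearMap

theorem lowering_apply {m : ℕ} (f : MvPolynomial (Fin m) ℂ) :
    lowering f = ∑ i, pderiv i f := by
  simp [lowering]

/-- `DRel c γ f g` says that `g` is the image of `f` under the deformed second order operator
`∑ γᵢ⁻¹ xᵢ ∂ᵢ² - c ∑_{i<j} (xᵢ + xⱼ) (γⱼ ∂ᵢ - γᵢ ∂ⱼ) / (xᵢ - xⱼ)`; in particular all the quotients
occurring in it are polynomials. -/
def DRel (c : ℂ) {m : ℕ} (γ : Fin m → ℂ) (f g : MvPolynomial (Fin m) ℂ) : Prop :=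
  ∃ q : Fin m → Fin m → MvPolynomial (Fin m) ℂ, (∀ i, q i i = 0) ∧
    (∀ i j, (X i - X j) * q i j = C (γ j) * pderiv i f - C (γ i) * pderiv j f) ∧
    g = ∑ i, C (γ i)⁻¹ * X i * pderiv i (pderiv i f) -
      C (c / 2) * ∑ i, ∑ j, (X i + X j) * q i j

theorem X_sub_X_ne_zero {m : ℕ} {i j : Fin m} (h : i ≠ j) :
    (X i - X j : MvPolynomial (Fin m) ℂ) ≠ 0 := by
  rw [sub_ne_zero]
  exact fun h' => h (X_injective h')

theorem totalDegree_pderiv_add_one_le {m : ℕ} {f : MvPolynomial (Fin m) ℂ} {i : Fin m}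
    (h : pderiv i f ≠ 0) : (pderiv i f).totalDegree + 1 ≤ f.totalDegree := by
  obtain ⟨s, hs, hs'⟩ := Finset.exists_mem_eq_sup _ (support_nonempty.2 h)
    (fun s : Fin m →₀ ℕ => s.sum fun _ e => e)
  rw [mem_support_iff, coeff_pderiv] at hs
  have h1 := le_totalDegree (mem_support_iff.2 (left_ne_zero_of_mul hs))
  rw [Finsupp.sum_add_index' (by simp) (by simp)] at h1
  simpa [totalDegree, hs'] using h1

namespace DRel

variable {c : ℂ} {m : ℕ} {γ : Fin m → ℂ} {f g h k : MvPolynomial (Fin m) ℂ}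

theorem unique (h₁ : DRel c γ f g) (h₂ : DRel c γ f h) : g = h := by
  obtain ⟨q, q0, hq, rfl⟩ := h₁
  obtain ⟨r, r0, hr, rfl⟩ := h₂
  have : q = r := by
    funext i j
    by_cases hij : i = j
    · subst hij; rw [q0, r0]
    · exact mul_left_cancel₀ (X_sub_X_ne_zero hij) ((hq i j).trans (hr i j).symm)
  rw [this]

theorem zero : DRel c γ 0 0 := ⟨fun _ _ => 0, by simp, by simp, by simp⟩

theorem const (x : ℂ) : DRel c γ (C x) 0 := ⟨fun _ _ => 0, by simp, by simp, by simp⟩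

theorem add (h₁ : DRel c γ f g) (h₂ : DRel c γ h k) : DRel c γ (f + h) (g + k) := by
  obtain ⟨q, q0, hq, rfl⟩ := h₁
  obtain ⟨r, r0, hr, rfl⟩ := h₂
  refine ⟨fun i j => q i j + r i j, by simp [q0, r0], fun i j => ?_, ?_⟩
  · rw [mul_add, hq, hr, map_add, map_add]; ring
  · simp only [map_add, mul_add, Finset.sum_add_distrib]; ring

theorem mul (h₁ : DRel c γ f g) (h₂ : DRel c γ h k) : DRel c γ (f * h)
    (f * k + h * g + 2 * ∑ i, C (γ i)⁻¹ * X i * pderiv i f * pderiv i h) := by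
  obtain ⟨q, q0, hq, rfl⟩ := h₁
  obtain ⟨r, r0, hr, rfl⟩ := h₂
  refine ⟨fun i j => f * r i j + h * q i j, by simp [q0, r0], fun i j => ?_, ?_⟩
  · simp only [Derivation.leibniz, smul_eq_mul]
    linear_combination f * hr i j + h * hq i j
  · have e1 : ∑ i, ∑ j, (X i + X j) * (f * r i j + h * q i j) =
        f * ∑ i, ∑ j, (X i + X j) * r i j + h * ∑ i, ∑ j, (X i + X j) * q i j := by
      simp only [Finset.mul_sum, ← Finset.sum_add_distrib]
      refine Finset.sum_congr rfl fun i _ => Finset.sum_congr rfl fun j _ => by ring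
    have e2 : ∑ i, C (γ i)⁻¹ * X i * pderiv i (pderiv i (f * h)) =
        f * ∑ i, C (γ i)⁻¹ * X i * pderiv i (pderiv i h) +
        h * ∑ i, C (γ i)⁻¹ * X i * pderiv i (pderiv i f) +
        2 * ∑ i, C (γ i)⁻¹ * X i * pderiv i f * pderiv i h := by
      simp only [Finset.mul_sum, ← Finset.sum_add_distrib]
      refine Finset.sum_congr rfl fun i _ => ?_
      simp only [Derivation.leibniz, smul_eq_mul, map_add]
      ring
    rw [e1, e2]; ring

theorem const_mul (x : ℂ) (h₁ : DRel c γ f g) : DRel c γ (C x * f) (C x * g) := by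
  simpa using (const x).mul h₁

theorem symm_quot {q : Fin m → Fin m → MvPolynomial (Fin m) ℂ}
    (hq : ∀ i j, (X i - X j) * q i j = C (γ j) * pderiv i f - C (γ i) * pderiv j f)
    (i j : Fin m) : q i j = q j i := by
  by_cases hij : i = j
  · subst hij; rfl
  · refine mul_left_cancel₀ (X_sub_X_ne_zero hij) ?_
    linear_combination hq i j + hq j i

theorem totalDegree_add_one_le (h₁ : DRel c γ f g) (hg : g ≠ 0) :
    g.totalDegree + 1 ≤ f.totalDegree := by
  have hf : f.totalDegree ≠ 0 := fun h0 => by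
    rw [totalDegree_eq_zero_iff_eq_C.1 h0] at h₁
    exact hg (h₁.unique (const _))
  obtain ⟨n, hn⟩ := Nat.exists_eq_succ_of_ne_zero hf
  obtain ⟨q, q0, hq, rfl⟩ := h₁
  have hX : ∀ i, (X i : MvPolynomial (Fin m) ℂ).totalDegree ≤ 1 := fun i => by
    rw [totalDegree_X]
  have hC : ∀ (x : ℂ) (p : MvPolynomial (Fin m) ℂ), (C x * p).totalDegree ≤ p.totalDegree :=
    fun x p => (totalDegree_mul _ _).trans (by simp)
  have hd : ∀ i, (pderiv i f).totalDegree ≤ n := fun i => by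
    by_cases h0 : pderiv i f = 0
    · simp [h0]
    have := totalDegree_pderiv_add_one_le h0
    omega
  have hterm1 : ∀ i, (C (γ i)⁻¹ * X i * pderiv i (pderiv i f)).totalDegree ≤ n := fun i => by
    by_cases h0 : pderiv i (pderiv i f) = 0
    · simp [h0]
    have := totalDegree_pderiv_add_one_le h0
    rw [mul_assoc]
    have h2 := hC (γ i)⁻¹ (X i * pderiv i (pderiv i f))
    have h3 := totalDegree_mul (X i) (pderiv i (pderiv i f))
    have := hX i
    have := hd i
    omega
  have hterm2 : ∀ i j, ((X i + X j) * q i j).totalDegree ≤ n := fun i j => by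
    by_cases hij : i = j
    · subst hij; simp [q0]
    by_cases h0 : q i j = 0
    · simp [h0]
    have h1 := totalDegree_mul_of_isDomain (X_sub_X_ne_zero hij) h0
    have h2 : ((X i - X j) * q i j).totalDegree ≤ n := by
      rw [hq]
      exact (totalDegree_sub _ _).trans
        (max_le ((hC _ _).trans (hd i)) ((hC _ _).trans (hd j)))
    have h3 : (X i - X j : MvPolynomial (Fin m) ℂ).totalDegree ≠ 0 := fun h => by
      have h4 := congrArg (pderiv i) (totalDegree_eq_zero_iff_eq_C.1 h)
      simp [pderiv_X, hij] at h4
    have h4 := totalDegree_mul (X i + X j) (q i j)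
    have h5 : (X i + X j : MvPolynomial (Fin m) ℂ).totalDegree ≤ 1 :=
      (totalDegree_add _ _).trans (max_le (hX i) (hX j))
    omega
  rw [hn, Nat.succ_eq_add_one, Nat.add_le_add_iff_right]
  refine (totalDegree_sub _ _).trans (max_le ?_ ((hC _ _).trans ?_))
  · exact totalDegree_finsetSum_le fun i _ => hterm1 i
  · exact totalDegree_finsetSum_le fun i _ => totalDegree_finsetSum_le fun j _ => hterm2 i j

end DRel

theorem coeff_X_add_C_mul {R : Type*} [CommRing R] [IsDomain R] {x : R} {Q : Polynomial R} {t : ℕ}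
    (h : ((Polynomial.X - Polynomial.C x) * Q).natDegree ≤ t) :
    ((Polynomial.X + Polynomial.C x) * Q).coeff t =
      ((Polynomial.X - Polynomial.C x) * Q).coeff t := by
  have : Q.coeff t = 0 := by
    by_cases hQ : Q = 0
    · simp [hQ]
    rw [Polynomial.natDegree_mul (Polynomial.X_sub_C_ne_zero x) hQ,
      Polynomial.natDegree_X_sub_C] at h
    exact Polynomial.coeff_eq_zero_of_natDegree_lt (by omega)
  simp [add_mul, sub_mul, this]

/-- The operator on a top coefficient with respect to the variable `0`. -/
theorem DRel.coeff {c : ℂ} {m : ℕ} {γ₀ : ℂ} {γ : Fin m → ℂ}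
    {f g : MvPolynomial (Fin (m + 1)) ℂ} (h : DRel c (Fin.cons γ₀ γ) f g) {t : ℕ}
    (ht : (finSuccEquiv ℂ m f).natDegree ≤ t) :
    DRel c γ ((finSuccEquiv ℂ m f).coeff t) ((finSuccEquiv ℂ m g).coeff t -
      C (c * γ₀) * lowering ((finSuccEquiv ℂ m f).coeff t)) := by
  obtain ⟨q, q0, hq, rfl⟩ := h
  set F := finSuccEquiv ℂ m f with hF
  have hF1 : ∀ s, t < s → F.coeff s = 0 := fun s hs =>
    Polynomial.coeff_eq_zero_of_natDegree_lt (by omega)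
  have hC : ∀ x : ℂ, finSuccEquiv ℂ m (C x) = Polynomial.C (C x) := fun x => by
    simp [finSuccEquiv_apply]
  refine ⟨fun i j => (finSuccEquiv ℂ m (q i.succ j.succ)).coeff t, by simp [q0], fun i j => ?_, ?_⟩
  · have := congrArg (fun p => (finSuccEquiv ℂ m p).coeff t) (hq i.succ j.succ)
    have hX : finSuccEquiv ℂ m (X i.succ - X j.succ) = Polynomial.C (X i - X j) := by
      rw [map_sub, finSuccEquiv_X_succ, finSuccEquiv_X_succ, map_sub]
    simpa only [map_mul, hX, map_sub (finSuccEquiv ℂ m) (C _ * _), hC, Fin.cons_succ,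
      Polynomial.coeff_sub, Polynomial.coeff_C_mul, coeff_finSuccEquiv_pderiv_succ] using this
  · have key : ∀ j : Fin m, (finSuccEquiv ℂ m ((X 0 + X j.succ) * q 0 j.succ)).coeff t =
        - (C γ₀ * pderiv j (F.coeff t)) := by
      intro j
      have h1 := congrArg (finSuccEquiv ℂ m) (hq 0 j.succ)
      simp only [map_mul, map_sub, finSuccEquiv_X_zero, finSuccEquiv_X_succ, Fin.cons_succ,
        Fin.cons_zero, hC, finSuccEquiv_pderiv_zero] at h1
      have h2 : ((Polynomial.X - Polynomial.C (X j)) *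
          finSuccEquiv ℂ m (q 0 j.succ)).natDegree ≤ t := by
        rw [h1, Polynomial.natDegree_le_iff_coeff_eq_zero]
        intro s hs
        simp [coeff_finSuccEquiv_pderiv_succ, Polynomial.coeff_derivative, ← hF, hF1 s hs,
          hF1 (s + 1) (by omega)]
      have h3 := coeff_X_add_C_mul h2
      rw [h1] at h3
      simp only [map_mul, map_add, finSuccEquiv_X_zero, finSuccEquiv_X_succ, h3]
      simp [coeff_finSuccEquiv_pderiv_succ, Polynomial.coeff_derivative, ← hF,
        hF1 (t + 1) (by omega)]
    have key0 : (finSuccEquiv ℂ m (C γ₀⁻¹ * X 0 * pderiv 0 (pderiv 0 f))).coeff t = 0 := by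
      simp only [map_mul, hC, finSuccEquiv_X_zero, finSuccEquiv_pderiv_zero, ← hF, mul_assoc,
        Polynomial.coeff_C_mul]
      cases t with
      | zero => simp
      | succ s => simp [Polynomial.coeff_derivative, hF1 (s + 2) (by omega)]
    have hs := symm_quot hq
    have e1 : ∑ i, ∑ j, (X i + X j) * q i j = 2 * ∑ j : Fin m, (X 0 + X j.succ) * q 0 j.succ +
        ∑ i : Fin m, ∑ j : Fin m, (X i.succ + X j.succ) * q i.succ j.succ := by
      rw [Fin.sum_univ_succ]
      simp only [Fin.sum_univ_succ (n := m), Finset.sum_add_distrib, q0]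
      have : ∀ x : Fin m, (X x.succ + X 0) * q x.succ 0 = (X 0 + X x.succ) * q 0 x.succ :=
        fun x => by rw [hs x.succ 0]; ring
      simp only [this]; ring
    have e2 : (finSuccEquiv ℂ m (∑ j : Fin m, (X 0 + X j.succ) * q 0 j.succ)).coeff t =
        - (C γ₀ * lowering (F.coeff t)) := by
      rw [map_sum, Polynomial.finsetSum_coeff, lowering_apply, Finset.mul_sum,
        ← Finset.sum_neg_distrib]
      exact Finset.sum_congr rfl fun j _ => key j
    have e3 : (finSuccEquiv ℂ m (∑ i : Fin m, ∑ j : Fin m,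
        (X i.succ + X j.succ) * q i.succ j.succ)).coeff t =
        ∑ i : Fin m, ∑ j : Fin m, (X i + X j) * (finSuccEquiv ℂ m (q i.succ j.succ)).coeff t := by
      have hX : ∀ i j : Fin m, finSuccEquiv ℂ m (X i.succ + X j.succ) =
          Polynomial.C (X i + X j) := fun i j => by
        rw [map_add, finSuccEquiv_X_succ, finSuccEquiv_X_succ, map_add]
      simp only [map_sum, Polynomial.finsetSum_coeff, map_mul, hX, Polynomial.coeff_C_mul]
    have e4 : (finSuccEquiv ℂ m (∑ i : Fin m,
        C (γ i)⁻¹ * X i.succ * pderiv i.succ (pderiv i.succ f))).coeff t =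
        ∑ i : Fin m, C (γ i)⁻¹ * X i * pderiv i (pderiv i (F.coeff t)) := by
      simp only [map_sum, Polynomial.finsetSum_coeff, map_mul, finSuccEquiv_X_succ, hC,
        mul_assoc, Polynomial.coeff_C_mul, coeff_finSuccEquiv_pderiv_succ, hF]
    rw [e1, Fin.sum_univ_succ]
    simp only [Fin.cons_zero, Fin.cons_succ]
    rw [map_sub, Polynomial.coeff_sub, map_add, Polynomial.coeff_add, key0, e4, map_mul, hC,
      Polynomial.coeff_C_mul, map_add, Polynomial.coeff_add, e3, two_mul, map_add,
      Polynomial.coeff_add, e2]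
    have : (C (c * γ₀) : MvPolynomial (Fin m) ℂ) = 2 * (C (c / 2) * C γ₀) := by
      rw [← C_mul, ← map_ofNat C 2, ← C_mul]; congr 1; ring
    rw [this]; ring

/-- Setting all variables but the variable `0` to zero. -/
noncomputable def pureZero (m : ℕ) : MvPolynomial (Fin (m + 1)) ℂ →+* Polynomial ℂ :=
  (Polynomial.mapRingHom constantCoeff).comp (finSuccEquiv ℂ m).toRingEquiv.toRingHom

theorem pureZero_apply {m : ℕ} (f : MvPolynomial (Fin (m + 1)) ℂ) :
    pureZero m f = (finSuccEquiv ℂ m f).map constantCoeff := rfl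

theorem coeff_pureZero {m : ℕ} (f : MvPolynomial (Fin (m + 1)) ℂ) (t : ℕ) :
    (pureZero m f).coeff t = constantCoeff ((finSuccEquiv ℂ m f).coeff t) := by
  rw [pureZero_apply, Polynomial.coeff_map]

@[simp] theorem pureZero_C {m : ℕ} (x : ℂ) : pureZero m (C x) = Polynomial.C x := by
  simp [pureZero_apply, finSuccEquiv_apply]

@[simp] theorem pureZero_X_zero {m : ℕ} : pureZero m (X 0) = Polynomial.X := by
  simp [pureZero_apply, finSuccEquiv_X_zero]

@[simp] theorem pureZero_X_succ {m : ℕ} (j : Fin m) : pureZero m (X j.succ) = 0 := by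
  simp [pureZero_apply, finSuccEquiv_X_succ]

@[simp] theorem pureZero_pderiv_zero {m : ℕ} (f : MvPolynomial (Fin (m + 1)) ℂ) :
    pureZero m (pderiv 0 f) = Polynomial.derivative (pureZero m f) := by
  rw [pureZero_apply, finSuccEquiv_pderiv_zero, pureZero_apply, Polynomial.derivative_map]

theorem DRel.pureZero {c : ℂ} {m : ℕ} {γ₀ : ℂ} {γ : Fin m → ℂ}
    {f g : MvPolynomial (Fin (m + 1)) ℂ} (h : DRel c (Fin.cons γ₀ γ) f g) :
    pureZero m g = Polynomial.C γ₀⁻¹ * Polynomial.X *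
        Polynomial.derivative (Polynomial.derivative (pureZero m f)) -
      Polynomial.C (c * ∑ j, γ j) * Polynomial.derivative (pureZero m f) +
      Polynomial.C (c * γ₀) * (pureZero m (lowering f) -
        Polynomial.derivative (pureZero m f)) := by
  obtain ⟨q, q0, hq, rfl⟩ := h
  have hs := symm_quot hq
  have e0 : ∀ j : Fin m, Polynomial.X * FoulkesHowe.pureZero m (q 0 j.succ) =
      Polynomial.C (γ j) * Polynomial.derivative (FoulkesHowe.pureZero m f) -
        Polynomial.C γ₀ * FoulkesHowe.pureZero m (pderiv j.succ f) := fun j => by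
    simpa using congrArg (FoulkesHowe.pureZero m) (hq 0 j.succ)
  have e1 : FoulkesHowe.pureZero m (∑ i, ∑ j, (X i + X j) * q i j) =
      2 * ∑ j : Fin m, Polynomial.X * FoulkesHowe.pureZero m (q 0 j.succ) := by
    simp only [Fin.sum_univ_succ (n := m), map_add, map_sum, map_mul, pureZero_X_zero,
      pureZero_X_succ, q0, hs _ 0]
    simp
    ring
  have e2 : FoulkesHowe.pureZero m (lowering f) =
      Polynomial.derivative (FoulkesHowe.pureZero m f) +
        ∑ j : Fin m, FoulkesHowe.pureZero m (pderiv j.succ f) := by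
    rw [lowering_apply, Fin.sum_univ_succ, map_add, map_sum, pureZero_pderiv_zero]
  have e3 : (Polynomial.C (c / 2) * 2 : Polynomial ℂ) = Polynomial.C c := by
    rw [← map_ofNat Polynomial.C 2, ← Polynomial.C_mul]; congr 1; ring
  rw [map_sub, map_mul, e1, e2, Fin.sum_univ_succ]
  simp only [e0, Finset.sum_sub_distrib, ← Finset.mul_sum, ← Finset.sum_mul, Fin.cons_zero,
    Fin.cons_succ, map_add, map_mul, map_sum, pureZero_C, pureZero_X_zero, pureZero_X_succ,
    pureZero_pderiv_zero, mul_zero, zero_mul, Finset.sum_const_zero]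
  linear_combination (- (∑ i, Polynomial.C (γ i)) * Polynomial.derivative (FoulkesHowe.pureZero m f)
    + Polynomial.C γ₀ * ∑ i : Fin m, FoulkesHowe.pureZero m (pderiv i.succ f)) * e3

/-- The degree in the variable `0` of a pure power of this variable occurring in a solution. -/
theorem DRel.eq_zero_or_degree_eq {c : ℂ} {m : ℕ} {γ₀ : ℂ} {γ : Fin m → ℂ} (h0 : γ₀ ≠ 0)
    {f g : MvPolynomial (Fin (m + 1)) ℂ} (h : DRel c (Fin.cons γ₀ γ) f g)
    (hg : FoulkesHowe.pureZero m g = 0) (hl : FoulkesHowe.pureZero m (lowering f) = 0) {t : ℕ}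
    (ht : constantCoeff ((finSuccEquiv ℂ m f).coeff t) ≠ 0) :
    t = 0 ∨ (t : ℂ) - 1 = c * γ₀ * (γ₀ + ∑ j, γ j) := by
  rw [← coeff_pureZero] at ht
  have := h.pureZero
  rw [hg, hl] at this
  cases t with
  | zero => exact Or.inl rfl
  | succ t =>
    right
    have h1 := congrArg (fun p => p.coeff t) this
    have h2 : (Polynomial.X * Polynomial.derivative (Polynomial.derivative
        (FoulkesHowe.pureZero m f))).coeff t =
        t * (t + 1) * (FoulkesHowe.pureZero m f).coeff (t + 1) := by
      cases t with
      | zero => simp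
      | succ t => simp [Polynomial.coeff_derivative]; ring
    simp only [zero_sub, mul_neg, Polynomial.coeff_add, Polynomial.coeff_sub, Polynomial.coeff_neg,
      mul_assoc, Polynomial.coeff_C_mul, Polynomial.coeff_zero, h2, Polynomial.coeff_derivative] at h1
    have h3 : ((t : ℂ) + 1) ≠ 0 := Nat.cast_add_one_ne_zero t
    have h4 : (FoulkesHowe.pureZero m f).coeff (t + 1) * (t + 1) *
        ((t : ℂ) - c * γ₀ * (γ₀ + ∑ j, γ j)) = 0 := by
      field_simp at h1
      linear_combination - h1
    have := (mul_eq_zero.1 h4).resolve_left (mul_ne_zero ht h3)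
    push_cast
    linear_combination this

/-- Polynomials annihilated by the lowering operator and by the deformed second order operator. -/
def Lowest (c : ℂ) {m : ℕ} (γ : Fin m → ℂ) (f : MvPolynomial (Fin m) ℂ) : Prop :=
  lowering f = 0 ∧ DRel c γ f 0

theorem coeff_lowering {m : ℕ} (f : MvPolynomial (Fin (m + 1)) ℂ) (t : ℕ) :
    (finSuccEquiv ℂ m (lowering f)).coeff t = lowering ((finSuccEquiv ℂ m f).coeff t) +
      (finSuccEquiv ℂ m f).coeff (t + 1) * (t + 1) := by
  rw [lowering_apply, Fin.sum_univ_succ, map_add, Polynomial.coeff_add, map_sum,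
    Polynomial.finsetSum_coeff, finSuccEquiv_pderiv_zero, Polynomial.coeff_derivative,
    lowering_apply, add_comm]
  congr 1
  exact Finset.sum_congr rfl fun j _ => coeff_finSuccEquiv_pderiv_succ f j t

theorem Lowest.of_coeff {c : ℂ} {m : ℕ} {γ₀ : ℂ} {γ : Fin m → ℂ}
    {f g : MvPolynomial (Fin (m + 1)) ℂ} (h : DRel c (Fin.cons γ₀ γ) f g)
    (hl : (finSuccEquiv ℂ m (lowering f)).coeff (finSuccEquiv ℂ m f).natDegree = 0)
    (hg : (finSuccEquiv ℂ m g).coeff (finSuccEquiv ℂ m f).natDegree = 0) :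
    Lowest c γ (finSuccEquiv ℂ m f).leadingCoeff := by
  have h1 : lowering (finSuccEquiv ℂ m f).leadingCoeff = 0 := by
    rwa [coeff_lowering, Polynomial.coeff_eq_zero_of_natDegree_lt (Nat.lt_succ_self _), zero_mul,
      add_zero] at hl
  refine ⟨h1, ?_⟩
  have h2 := h.coeff le_rfl
  rw [Polynomial.coeff_natDegree] at h2
  rwa [h1, hg, mul_zero, sub_zero] at h2

theorem Lowest.leadingCoeff {c : ℂ} {m : ℕ} {γ₀ : ℂ} {γ : Fin m → ℂ}
    {f : MvPolynomial (Fin (m + 1)) ℂ} (h : Lowest c (Fin.cons γ₀ γ) f) :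
    Lowest c γ (finSuccEquiv ℂ m f).leadingCoeff :=
  Lowest.of_coeff h.2 (by simp [h.1]) (by simp)

theorem eq_C_of_natDegree_eq_zero {m : ℕ} {f : MvPolynomial (Fin (m + 1)) ℂ} {x : ℂ}
    (hx : (finSuccEquiv ℂ m f).leadingCoeff = C x) (h : (finSuccEquiv ℂ m f).natDegree = 0) :
    f = C x := by
  apply (finSuccEquiv ℂ m).injective
  rw [Polynomial.leadingCoeff, h] at hx
  rw [Polynomial.eq_C_of_natDegree_eq_zero h, hx]
  simp [finSuccEquiv_apply]

theorem Lowest.const_or_degree_eq {c : ℂ} {m : ℕ} {γ₀ : ℂ} {γ : Fin m → ℂ} (h0 : γ₀ ≠ 0)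
    {f : MvPolynomial (Fin (m + 1)) ℂ} (h : Lowest c (Fin.cons γ₀ γ) f) {x : ℂ}
    (hx : (finSuccEquiv ℂ m f).leadingCoeff = C x) :
    f = C x ∨ ((finSuccEquiv ℂ m f).natDegree : ℂ) - 1 = c * γ₀ * (γ₀ + ∑ j, γ j) := by
  by_cases hx0 : x = 0
  · left
    subst hx0
    rw [C_0, Polynomial.leadingCoeff_eq_zero, EmbeddingLike.map_eq_zero_iff] at hx
    simp [hx]
  · rcases h.2.eq_zero_or_degree_eq h0 (t := (finSuccEquiv ℂ m f).natDegree) (by simp)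
      (by simp [h.1]) (by
        rw [Polynomial.coeff_natDegree, hx, constantCoeff_C]; exact hx0) with h1 | h1
    · exact Or.inl (eq_C_of_natDegree_eq_zero hx h1)
    · exact Or.inr h1

/-- Evaluation of the abstract power sums `p_r` at the weighted power sums `∑ γᵢ xᵢ ^ r`. -/
noncomputable def ev {m : ℕ} (γ : Fin m → ℂ) : MvPolynomial ℕ ℂ →ₐ[ℂ] MvPolynomial (Fin m) ℂ :=
  aeval fun r => ∑ i, C (γ i) * X i ^ r

@[simp] theorem ev_X {m : ℕ} (γ : Fin m → ℂ) (r : ℕ) :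
    ev γ (X r) = ∑ i, C (γ i) * X i ^ r := by simp [ev]

@[simp] theorem ev_C {m : ℕ} (γ : Fin m → ℂ) (x : ℂ) : ev γ (C x) = C x := by
  simp [ev]

theorem pderiv_ev_X {m : ℕ} (γ : Fin m → ℂ) (r : ℕ) (i : Fin m) :
    pderiv i (ev γ (X r)) = C (γ i) * ((r : MvPolynomial (Fin m) ℂ) * X i ^ (r - 1)) := by
  rw [ev_X, map_sum, Finset.sum_eq_single i]
  · simp [pderiv_X]
  · intro j _ hj
    simp [pderiv_X, hj]
  · simp

theorem exists_sum_X_pow_mul_pderiv (r : ℕ) (φ : MvPolynomial ℕ ℂ) :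
    ∃ ψ : MvPolynomial ℕ ℂ, ∀ (m : ℕ) (γ : Fin m → ℂ),
      ∑ i, X i ^ r * pderiv i (ev γ φ) = ev γ ψ := by
  induction φ using MvPolynomial.induction_on with
  | C x => exact ⟨0, by simp⟩
  | add φ φ' h h' =>
    obtain ⟨ψ, hψ⟩ := h
    obtain ⟨ψ', hψ'⟩ := h'
    exact ⟨ψ + ψ', fun m γ => by
      simp only [map_add, mul_add, Finset.sum_add_distrib, hψ, hψ']⟩
  | mul_X φ s h =>
    obtain ⟨ψ, hψ⟩ := h
    refine ⟨φ * ((s : MvPolynomial ℕ ℂ) * X (r + s - 1)) + ψ * X s, fun m γ => ?_⟩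
    simp only [map_mul, map_add, ← hψ, map_natCast, Derivation.leibniz, smul_eq_mul, pderiv_ev_X]
    rw [Finset.sum_mul, ev_X _ (r + s - 1), Finset.mul_sum, Finset.mul_sum,
      ← Finset.sum_add_distrib]
    refine Finset.sum_congr rfl fun i _ => ?_
    cases s with
    | zero => simp; ring
    | succ s =>
      rw [← add_assoc, Nat.add_sub_cancel, Nat.add_sub_cancel]
      ring

theorem exists_lowering (φ : MvPolynomial ℕ ℂ) : ∃ ψ : MvPolynomial ℕ ℂ,
    ∀ (m : ℕ) (γ : Fin m → ℂ), lowering (ev γ φ) = ev γ ψ := by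
  simpa [lowering_apply] using exists_sum_X_pow_mul_pderiv 0 φ

/-- The image of the power sum `p_r` under the deformed second order operator. -/
noncomputable def powerSumImage (c : ℂ) (r : ℕ) : MvPolynomial ℕ ℂ :=
  C ((1 + c) * (r * (r - 1))) * X (r - 1) - C (c / 2) * ((r : MvPolynomial ℕ ℂ) *
    ∑ t ∈ Finset.range (r - 1), (X (t + 1) * X (r - 2 - t) + X t * X (r - 1 - t)))

theorem DRel.ev_X {c : ℂ} {m : ℕ} {γ : Fin m → ℂ} (h0 : ∀ i, γ i ≠ 0)
    (h1 : ∀ i, 1 + c * γ i ^ 2 = (1 + c) * γ i) (r : ℕ) :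
    DRel c γ (ev γ (X r)) (ev γ (powerSumImage c r)) := by
  rw [powerSumImage]
  obtain _ | _ | s := r
  · have := const (γ := γ) (c := c) (∑ i, γ i)
    rw [map_sum] at this
    simpa using this
  · refine ⟨fun _ _ => 0, by simp, fun i j => ?_, ?_⟩
    · simp only [pderiv_ev_X, zero_add]; simp; ring
    · simp only [pderiv_ev_X, zero_add]; simp
  classical
  refine ⟨fun i j => if i = j then 0 else C (γ i * γ j) * (((s + 2 : ℕ) : MvPolynomial (Fin m) ℂ) *
    ∑ t ∈ Finset.range (s + 1), X i ^ t * X j ^ (s - t)), by simp, fun i j => ?_, ?_⟩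
  · dsimp only
    split_ifs with hij
    · subst hij; simp
    have := Commute.geom_sum₂_mul (Commute.all (X i : MvPolynomial (Fin m) ℂ) (X j)) (s + 1)
    simp only [Nat.add_sub_cancel] at this
    simp only [pderiv_ev_X, C_mul, show s + 2 - 1 = s + 1 by omega]
    linear_combination (C (γ i) * C (γ j) * ((s + 2 : ℕ) : MvPolynomial (Fin m) ℂ)) * this
  · have e1 : ∀ i j : Fin m, (X i + X j) * (if i = j then 0 else C (γ i * γ j) * (((s + 2 : ℕ) : MvPolynomial (Fin m) ℂ) *
        ∑ t ∈ Finset.range (s + 1), X i ^ t * X j ^ (s - t))) =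
        ((s + 2 : ℕ) : MvPolynomial (Fin m) ℂ) * (∑ t ∈ Finset.range (s + 1), ((C (γ i) * X i ^ (t + 1)) *
          (C (γ j) * X j ^ (s - t)) + (C (γ i) * X i ^ t) * (C (γ j) * X j ^ (s + 1 - t)))) -
        if i = j then C (γ i ^ 2) * (2 * ((s + 2 : ℕ) : MvPolynomial (Fin m) ℂ) * ((s + 1 : ℕ) : MvPolynomial (Fin m) ℂ) * X i ^ (s + 1)) else 0 := by
      intro i j
      have : (X i + X j) * (C (γ i * γ j) * (((s + 2 : ℕ) : MvPolynomial (Fin m) ℂ) *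
        ∑ t ∈ Finset.range (s + 1), X i ^ t * X j ^ (s - t))) =
        ((s + 2 : ℕ) : MvPolynomial (Fin m) ℂ) * (∑ t ∈ Finset.range (s + 1), ((C (γ i) * X i ^ (t + 1)) *
          (C (γ j) * X j ^ (s - t)) + (C (γ i) * X i ^ t) * (C (γ j) * X j ^ (s + 1 - t)))) := by
        simp only [Finset.mul_sum]
        refine Finset.sum_congr rfl fun t ht => ?_
        rw [Finset.mem_range] at ht
        rw [show s + 1 - t = s - t + 1 by omega, C_mul]
        ring
      split_ifs with hij
      · subst hij
        rw [← this, mul_zero, eq_comm, sub_eq_zero]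
        have : ∑ t ∈ Finset.range (s + 1), (X i : MvPolynomial (Fin m) ℂ) ^ t * X i ^ (s - t) =
            ((s + 1 : ℕ) : MvPolynomial (Fin m) ℂ) * X i ^ s := by
          rw [Finset.sum_congr rfl (g := fun _ => X i ^ s)]
          · simp
          · intro t ht
            rw [Finset.mem_range] at ht
            rw [← pow_add]; congr 1; omega
        rw [this, C_mul, C_pow]; ring
      · rw [this, sub_zero]
    have e2 : ∑ i, ∑ j, (X i + X j) * (if i = j then 0 else C (γ i * γ j) * (((s + 2 : ℕ) : MvPolynomial (Fin m) ℂ) *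
        ∑ t ∈ Finset.range (s + 1), X i ^ t * X j ^ (s - t))) =
        ((s + 2 : ℕ) : MvPolynomial (Fin m) ℂ) * (∑ t ∈ Finset.range (s + 1), (ev γ (X (t + 1)) * ev γ (X (s - t)) +
          ev γ (X t) * ev γ (X (s + 1 - t)))) -
        ∑ i, C (γ i ^ 2) * (2 * ((s + 2 : ℕ) : MvPolynomial (Fin m) ℂ) * ((s + 1 : ℕ) : MvPolynomial (Fin m) ℂ) * X i ^ (s + 1)) := by
      simp only [e1, Finset.sum_sub_distrib, ← Finset.mul_sum, Finset.sum_ite_eq, Finset.mem_univ, if_true]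
      congr 2
      rw [Finset.sum_congr rfl fun i _ => Finset.sum_comm, Finset.sum_comm]
      simp only [FoulkesHowe.ev_X, Finset.sum_mul_sum, Finset.sum_add_distrib]
    have e3 : ∀ i : Fin m, C (γ i)⁻¹ * X i * pderiv i (pderiv i (ev γ (X (s + 2)))) =
        ((s + 2 : ℕ) : MvPolynomial (Fin m) ℂ) * ((s + 1 : ℕ) : MvPolynomial (Fin m) ℂ) * X i ^ (s + 1) := by
      intro i
      have : (C (γ i)⁻¹ * C (γ i) : MvPolynomial (Fin m) ℂ) = 1 := by
        rw [← C_mul, inv_mul_cancel₀ (h0 i), C_1]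
      rw [pderiv_ev_X]
      simp only [Derivation.leibniz, Derivation.leibniz_pow, pderiv_X_self, pderiv_C,
        Derivation.map_natCast, smul_eq_mul, nsmul_eq_mul,
        show s + 2 - 1 = s + 1 by omega, Nat.add_sub_cancel]
      linear_combination (((s + 2 : ℕ) : MvPolynomial (Fin m) ℂ) * ((s + 1 : ℕ) : MvPolynomial (Fin m) ℂ) * X i ^ (s + 1)) * this
    have e4 : ev γ (C ((1 + c) * (((s + 2 : ℕ) : ℂ) * ((s + 2 : ℕ) - 1))) * X (s + 1)) =
        ∑ i : Fin m, ((s + 2 : ℕ) : MvPolynomial (Fin m) ℂ) * ((s + 1 : ℕ) : MvPolynomial (Fin m) ℂ) *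
          X i ^ (s + 1) + C (c / 2) * ∑ i, C (γ i ^ 2) * (2 * ((s + 2 : ℕ) : MvPolynomial (Fin m) ℂ) *
            ((s + 1 : ℕ) : MvPolynomial (Fin m) ℂ) * X i ^ (s + 1)) := by
      rw [map_mul, FoulkesHowe.ev_C, FoulkesHowe.ev_X, Finset.mul_sum, Finset.mul_sum,
        ← Finset.sum_add_distrib]
      refine Finset.sum_congr rfl fun i _ => ?_
      have h2 : (C ((1 + c) * γ i) : MvPolynomial (Fin m) ℂ) = 1 + 2 * (C (c / 2) * C (γ i ^ 2)) := by
        rw [← h1, ← C_mul, ← map_ofNat C 2, ← C_mul, ← C_1, ← C_add]; congr 1; ring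
      have h3 : (C ((1 + c) * (((s + 2 : ℕ) : ℂ) * ((s + 2 : ℕ) - 1))) : MvPolynomial (Fin m) ℂ) =
          C (1 + c) * (((s + 2 : ℕ) : MvPolynomial (Fin m) ℂ) * ((s + 1 : ℕ) : MvPolynomial (Fin m) ℂ)) := by
        rw [← map_natCast C (s + 2), ← map_natCast C (s + 1), ← C_mul, ← C_mul]
        congr 1; push_cast; ring
      rw [C_mul] at h2
      rw [h3]
      linear_combination (((s + 2 : ℕ) : MvPolynomial (Fin m) ℂ) * ((s + 1 : ℕ) : MvPolynomial (Fin m) ℂ) * X i ^ (s + 1)) * h2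
    rw [show s + 1 + 1 = s + 2 from rfl, e2, Finset.sum_congr rfl fun i _ => e3 i]
    simp only [show s + 2 - 1 = s + 1 by omega, Nat.add_sub_cancel]
    rw [map_sub, e4, map_mul, map_mul, map_natCast, map_sum, FoulkesHowe.ev_C]
    simp only [map_add, map_mul]
    ring

theorem exists_DRel (c : ℂ) (φ : MvPolynomial ℕ ℂ) : ∃ ψ : MvPolynomial ℕ ℂ,
    ∀ (m : ℕ) (γ : Fin m → ℂ), (∀ i, γ i ≠ 0) → (∀ i, 1 + c * γ i ^ 2 = (1 + c) * γ i) →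
      DRel c γ (ev γ φ) (ev γ ψ) := by
  induction φ using MvPolynomial.induction_on with
  | C x => exact ⟨0, fun m γ _ _ => by simpa using DRel.const x⟩
  | add φ φ' h h' =>
    obtain ⟨ψ, hψ⟩ := h
    obtain ⟨ψ', hψ'⟩ := h'
    exact ⟨ψ + ψ', fun m γ h0 h1 => by
      simpa only [map_add] using (hψ m γ h0 h1).add (hψ' m γ h0 h1)⟩
  | mul_X φ r h =>
    obtain ⟨ψ, hψ⟩ := h
    obtain ⟨χ, hχ⟩ := exists_sum_X_pow_mul_pderiv r φ
    refine ⟨φ * powerSumImage c r + X r * ψ + 2 * ((r : MvPolynomial ℕ ℂ) * χ), fun m γ h0 h1 => ?_⟩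
    · have h2 := (hψ m γ h0 h1).mul (DRel.ev_X h0 h1 r)
      have h3 : ∑ i, C (γ i)⁻¹ * X i * pderiv i (ev γ φ) * pderiv i (ev γ (X r)) =
          ev γ ((r : MvPolynomial ℕ ℂ) * χ) := by
        rw [map_mul, map_natCast, ← hχ, Finset.mul_sum]
        refine Finset.sum_congr rfl fun i _ => ?_
        have h4 : (C (γ i)⁻¹ * C (γ i) : MvPolynomial (Fin m) ℂ) = 1 := by
          rw [← C_mul, inv_mul_cancel₀ (h0 i), C_1]
        rw [pderiv_ev_X]
        cases r with
        | zero => simp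
        | succ r =>
          rw [Nat.add_sub_cancel]
          linear_combination (((r + 1 : ℕ) : MvPolynomial (Fin m) ℂ) * X i ^ (r + 1) * pderiv i (ev γ φ)) * h4
      rw [h3, ← map_ofNat (ev γ) 2, ← map_mul, ← map_mul, ← map_mul, ← map_mul, ← map_add,
        ← map_add] at h2
      exact h2

section Integral

variable {n : ℕ}

theorem finSuccEquiv_rename_succ (f : MvPolynomial (Fin n) ℂ) :
    finSuccEquiv ℂ n (rename Fin.succ f) = Polynomial.C f := by
  induction f using MvPolynomial.induction_on with
  | C x => simp [finSuccEquiv_apply]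
  | add p q hp hq => simp [hp, hq]
  | mul_X p i hp => simp [hp, finSuccEquiv_X_succ]

theorem finSucc_induction {P : MvPolynomial (Fin (n + 1)) ℂ → Prop}
    (add : ∀ F G, P F → P G → P (F + G))
    (mono : ∀ (f : MvPolynomial (Fin n) ℂ) (s : ℕ), P (rename Fin.succ f * X 0 ^ s))
    (F : MvPolynomial (Fin (n + 1)) ℂ) : P F := by
  rw [← (finSuccEquiv ℂ n).symm_apply_apply F]
  induction finSuccEquiv ℂ n F using Polynomial.induction_on' with
  | add p q hp hq => rw [map_add]; exact add _ _ hp hq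
  | monomial s f =>
    have : (finSuccEquiv ℂ n).symm (Polynomial.monomial s f) = rename Fin.succ f * X 0 ^ s := by
      rw [AlgEquiv.symm_apply_eq, map_mul, map_pow, finSuccEquiv_X_zero, finSuccEquiv_rename_succ,
        Polynomial.C_mul_X_pow_eq_monomial]
    rw [this]
    exact mono f s

/-- The sum over `i` of the integrals of `F` in the variable `0` from `0` to `xᵢ`. -/
noncomputable def integral (F : MvPolynomial (Fin (n + 1)) ℂ) : MvPolynomial (Fin n) ℂ :=
  Polynomial.lsum (fun s => LinearMap.mulRight (MvPolynomial (Fin n) ℂ)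
    (C ((s : ℂ) + 1)⁻¹ * psum (Fin n) ℂ (s + 1))) (finSuccEquiv ℂ n F)

theorem integral_add (F G : MvPolynomial (Fin (n + 1)) ℂ) :
    integral (F + G) = integral F + integral G := by
  rw [integral, map_add, map_add]; rfl

theorem integral_mono (f : MvPolynomial (Fin n) ℂ) (s : ℕ) :
    integral (rename Fin.succ f * X 0 ^ s) =
      f * (C ((s : ℂ) + 1)⁻¹ * psum (Fin n) ℂ (s + 1)) := by
  rw [integral, map_mul, map_pow, finSuccEquiv_X_zero, finSuccEquiv_rename_succ,
        Polynomial.C_mul_X_pow_eq_monomial, Polynomial.lsum_apply, Polynomial.sum_monomial_index]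
  · rfl
  · simp

theorem integral_rename_mul (f : MvPolynomial (Fin n) ℂ) (F : MvPolynomial (Fin (n + 1)) ℂ) :
    integral (rename Fin.succ f * F) = f * integral F := by
  rw [integral, map_mul, finSuccEquiv_rename_succ, ← Polynomial.smul_eq_C_mul, map_smul]
  rfl

theorem integral_C_mul (x : ℂ) (F : MvPolynomial (Fin (n + 1)) ℂ) :
    integral (C x * F) = C x * integral F := by
  rw [← integral_rename_mul, rename_C]

theorem integral_X_succ_mul (i : Fin n) (F : MvPolynomial (Fin (n + 1)) ℂ) :
    integral (X i.succ * F) = X i * integral F := by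
  rw [← integral_rename_mul, rename_X]

/-- `integral` as an additive map. -/
noncomputable def integralHom : MvPolynomial (Fin (n + 1)) ℂ →+ MvPolynomial (Fin n) ℂ :=
  AddMonoidHom.mk' integral integral_add

theorem integral_sum {ι : Type*} (s : Finset ι) (F : ι → MvPolynomial (Fin (n + 1)) ℂ) :
    integral (∑ i ∈ s, F i) = ∑ i ∈ s, integral (F i) :=
  map_sum integralHom F s

theorem integral_sub (F G : MvPolynomial (Fin (n + 1)) ℂ) :
    integral (F - G) = integral F - integral G :=
  map_sub integralHom F G

/-- Substitution of `f` for the variable `0`. -/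
noncomputable def subst (f : MvPolynomial (Fin n) ℂ) :
    MvPolynomial (Fin (n + 1)) ℂ →ₐ[ℂ] MvPolynomial (Fin n) ℂ :=
  aeval (Fin.cons f X)

@[simp] theorem subst_X_zero (f : MvPolynomial (Fin n) ℂ) : subst f (X 0) = f := by
  simp [subst]

@[simp] theorem subst_X_succ (f : MvPolynomial (Fin n) ℂ) (i : Fin n) :
    subst f (X i.succ) = X i := by
  simp [subst]

theorem subst_rename (f g : MvPolynomial (Fin n) ℂ) : subst f (rename Fin.succ g) = g := by
  have : (Fin.cons f X : Fin (n + 1) → MvPolynomial (Fin n) ℂ) ∘ Fin.succ = X := by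
    ext1 i; simp
  rw [subst, aeval_rename, this, aeval_X_left_apply]

theorem pderiv_zero_rename_succ (f : MvPolynomial (Fin n) ℂ) :
    pderiv 0 (rename Fin.succ f) = 0 := by
  apply (finSuccEquiv ℂ n).injective
  simp [finSuccEquiv_pderiv_zero, finSuccEquiv_rename_succ]

theorem pderiv_integral (i : Fin n) (F : MvPolynomial (Fin (n + 1)) ℂ) :
    pderiv i (integral F) = integral (pderiv i.succ F) + subst (X i) F := by
  induction F using finSucc_induction with
  | add F G hF hG => simp only [integral_add, map_add, hF, hG]; ring
  | mono f s =>
    have h1 : pderiv i (psum (Fin n) ℂ (s + 1)) = ((s : MvPolynomial (Fin n) ℂ) + 1) * X i ^ s := by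
      rw [psum, map_sum, Finset.sum_eq_single i]
      · simp [pderiv_X]
      · intro j _ hj
        simp [pderiv_X, hj]
      · simp
    have h2 : (C ((s : ℂ) + 1)⁻¹ * ((s : MvPolynomial (Fin n) ℂ) + 1) : MvPolynomial (Fin n) ℂ) = 1 := by
      rw [← map_natCast C, ← C_1, ← C_add, ← C_mul, inv_mul_cancel₀ (Nat.cast_add_one_ne_zero s)]
    have h3 : pderiv i.succ (rename Fin.succ f * X 0 ^ s) =
        rename Fin.succ (pderiv i f) * X 0 ^ s := by
      rw [Derivation.leibniz, pderiv_rename (Fin.succ_injective n), Derivation.leibniz_pow]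
      simp [pderiv_X, mul_comm, (Fin.succ_ne_zero i).symm]
    rw [h3, integral_mono, integral_mono]
    simp only [map_mul, map_pow, subst_rename, subst_X_zero, Derivation.leibniz, h1, smul_eq_mul,
      pderiv_C]
    linear_combination f * X i ^ s * h2

theorem integral_pderiv_zero (F : MvPolynomial (Fin (n + 1)) ℂ) :
    integral (pderiv 0 F) = ∑ i, (subst (X i) F - subst 0 F) := by
  induction F using finSucc_induction with
  | add F G hF hG =>
    simp only [integral_add, map_add, hF, hG, ← Finset.sum_add_distrib]
    exact Finset.sum_congr rfl fun i _ => by ring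
  | mono f s =>
    rw [Derivation.leibniz, pderiv_zero_rename_succ, Derivation.leibniz_pow, pderiv_X_self]
    simp only [map_mul, map_pow, subst_rename, subst_X_zero, ← mul_sub, smul_eq_mul]
    cases s with
    | zero => simpa using integral_rename_mul (n := n) 0 0
    | succ s =>
      have := integral_C_mul ((s + 1 : ℕ) : ℂ) (rename Fin.succ f * X 0 ^ s)
      rw [integral_mono] at this
      have h2 : (C ((s : ℂ) + 1)⁻¹ * ((s : MvPolynomial (Fin n) ℂ) + 1) : MvPolynomial (Fin n) ℂ) = 1 := by
        rw [← map_natCast C, ← C_1, ← C_add, ← C_mul,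
          inv_mul_cancel₀ (Nat.cast_add_one_ne_zero s)]
      have h3 : (rename Fin.succ f * (s + 1) • (X 0 ^ (s + 1 - 1) * 1) + X 0 ^ (s + 1) * 0 :
          MvPolynomial (Fin (n + 1)) ℂ) = C ((s + 1 : ℕ) : ℂ) * (rename Fin.succ f * X 0 ^ s) := by
        rw [map_natCast, nsmul_eq_mul, Nat.add_sub_cancel]; ring
      have h4 : (C ((s + 1 : ℕ) : ℂ) : MvPolynomial (Fin n) ℂ) = (s : MvPolynomial (Fin n) ℂ) + 1 := by
        rw [map_natCast]; push_cast; rfl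
      rw [h3, this, h4]
      simp only [zero_pow (Nat.succ_ne_zero s), sub_zero, ← Finset.mul_sum, psum]
      linear_combination f * (∑ i, X i ^ (s + 1)) * h2

theorem rename_integral (e : Equiv.Perm (Fin n)) (F : MvPolynomial (Fin (n + 1)) ℂ) :
    rename e (integral F) =
      integral (rename (Fin.cons 0 (Fin.succ ∘ e) : Fin (n + 1) → Fin (n + 1)) F) := by
  induction F using finSucc_induction with
  | add F G hF hG => simp only [integral_add, map_add, hF, hG]
  | mono f s =>
    have : rename (Fin.cons 0 (Fin.succ ∘ e) : Fin (n + 1) → Fin (n + 1))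
        (rename Fin.succ f * X 0 ^ s) = rename Fin.succ (rename e f) * X 0 ^ s := by
      rw [map_mul, map_pow, rename_X, rename_rename, rename_rename]
      rfl
    rw [this, integral_mono, integral_mono, map_mul, map_mul, rename_C, rename_psum]

end Integral

theorem Derivation.prod_pow_eq_zero {R : Type*} [CommRing R] [Algebra ℂ R] (D : Derivation ℂ R R)
    {ι : Type*} (s : Finset ι) (f : ι → R) (k : ℕ) (h : ∀ i ∈ s, D (f i) = 0) :
    D (∏ i ∈ s, f i ^ k) = 0 := by
  classical
  induction s using Finset.induction_on with
  | empty => simp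
  | insert i s hi ih =>
    rw [Finset.prod_insert hi, D.leibniz, D.leibniz_pow, h i (Finset.mem_insert_self _ _),
      ih fun j hj => h j (Finset.mem_insert_of_mem hj)]
    simp

section Kernel

variable {n : ℕ}

/-- The linear form `x₀ - x_{i+1}`. -/
noncomputable def lin (i : Fin n) : MvPolynomial (Fin (n + 1)) ℂ := X 0 - X i.succ

/-- The product of the `(α + 1)`-st powers of the linear forms `lin i`. -/
noncomputable def ker (n α : ℕ) : MvPolynomial (Fin (n + 1)) ℂ := ∏ l : Fin n, lin l ^ (α + 1)

/-- The quotient of `ker` by `lin i`. -/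
noncomputable def ker₁ (α : ℕ) (i : Fin n) : MvPolynomial (Fin (n + 1)) ℂ :=
  lin i ^ α * ∏ l ∈ Finset.univ.erase i, lin l ^ (α + 1)

/-- The quotient of `ker` by `lin i * lin j`. -/
noncomputable def ker₂ (α : ℕ) (i j : Fin n) : MvPolynomial (Fin (n + 1)) ℂ :=
  lin i ^ α * lin j ^ α * ∏ l ∈ (Finset.univ.erase i).erase j, lin l ^ (α + 1)

theorem ker_eq (α : ℕ) (i : Fin n) : ker n α = lin i * ker₁ α i := by
  rw [ker, ker₁, ← Finset.mul_prod_erase _ _ (Finset.mem_univ i)]; ring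

theorem ker₂_comm (α : ℕ) (i j : Fin n) : ker₂ α i j = ker₂ α j i := by
  rw [ker₂, ker₂, Finset.erase_right_comm]; ring

theorem ker₁_eq (α : ℕ) {i j : Fin n} (h : j ≠ i) : ker₁ α i = lin j * ker₂ α i j := by
  rw [ker₁, ker₂, ← Finset.mul_prod_erase _ _ (Finset.mem_erase.2 ⟨h, Finset.mem_univ j⟩)]; ring

theorem pderiv_succ_lin (i : Fin n) : pderiv i.succ (lin i) = -1 := by
  simp [lin, pderiv_X, (Fin.succ_ne_zero i).symm]

theorem pderiv_succ_lin_of_ne {i j : Fin n} (h : j ≠ i) : pderiv i.succ (lin j) = 0 := by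
  simp [lin, pderiv_X, h, (Fin.succ_ne_zero i).symm]

theorem pderiv_ker (α : ℕ) (i : Fin n) :
    pderiv i.succ (ker n α) = - (C ((α : ℂ) + 1) * ker₁ α i) := by
  rw [ker, ker₁, ← Finset.mul_prod_erase _ _ (Finset.mem_univ i), Derivation.leibniz,
    Derivation.prod_pow_eq_zero _ _ _ _ fun j hj => pderiv_succ_lin_of_ne (Finset.ne_of_mem_erase hj),
    Derivation.leibniz_pow, pderiv_succ_lin]
  simp [nsmul_eq_mul]
  ring

theorem pderiv_ker₁ (α : ℕ) {i j : Fin n} (h : j ≠ i) :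
    pderiv j.succ (ker₁ α i) = - (C ((α : ℂ) + 1) * ker₂ α i j) := by
  rw [ker₁, ker₂, ← Finset.mul_prod_erase _ _ (Finset.mem_erase.2 ⟨h, Finset.mem_univ j⟩),
    Derivation.leibniz, Derivation.leibniz,
    Derivation.prod_pow_eq_zero _ _ _ _ fun j hj => pderiv_succ_lin_of_ne (Finset.ne_of_mem_erase hj),
    Derivation.leibniz_pow, Derivation.leibniz_pow, pderiv_succ_lin, pderiv_succ_lin_of_ne h.symm]
  simp [nsmul_eq_mul]
  ring

theorem lin_mul_pderiv_ker₁ (α : ℕ) (i : Fin n) :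
    lin i * pderiv i.succ (ker₁ α i) = - (C (α : ℂ) * ker₁ α i) := by
  rw [ker₁, Derivation.leibniz,
    Derivation.prod_pow_eq_zero _ _ _ _ fun j hj => pderiv_succ_lin_of_ne (Finset.ne_of_mem_erase hj),
    Derivation.leibniz_pow, pderiv_succ_lin]
  cases α with
  | zero => simp
  | succ α =>
    simp [nsmul_eq_mul]
    ring

/-- The derivation `∑ ∂ᵢ`. -/
noncomputable def translation (n : ℕ) :
    Derivation ℂ (MvPolynomial (Fin (n + 1)) ℂ) (MvPolynomial (Fin (n + 1)) ℂ) := ∑ i, pderiv i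

theorem translation_apply (F : MvPolynomial (Fin (n + 1)) ℂ) :
    translation n F = pderiv 0 F + ∑ i : Fin n, pderiv i.succ F := by
  have := map_sum (Derivation.coeFnAddMonoidHom (R := ℂ) (A := MvPolynomial (Fin (n + 1)) ℂ)
    (M := MvPolynomial (Fin (n + 1)) ℂ)) pderiv Finset.univ
  rw [translation, ← Fin.sum_univ_succ (fun i => pderiv i F), ← Finset.sum_apply]
  exact congrFun this F

theorem translation_lin (i : Fin n) : translation n (lin i) = 0 := by
  rw [translation_apply, Finset.sum_eq_single i, pderiv_succ_lin]
  · simp [lin, pderiv_X, Fin.succ_ne_zero i]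
  · exact fun j _ hj => pderiv_succ_lin_of_ne hj.symm
  · simp

theorem pderiv_zero_ker (α : ℕ) :
    pderiv 0 (ker n α) = C ((α : ℂ) + 1) * ∑ i, ker₁ α i := by
  have h := translation_apply (ker n α)
  rw [ker, Derivation.prod_pow_eq_zero _ _ _ _ fun i _ => translation_lin i, ← ker] at h
  simp only [pderiv_ker, Finset.sum_neg_distrib, ← Finset.mul_sum] at h
  linear_combination -h

theorem pderiv_zero_ker₁ (α : ℕ) (i : Fin n) :
    pderiv 0 (ker₁ α i) = - pderiv i.succ (ker₁ α i) +
      C ((α : ℂ) + 1) * ∑ j ∈ Finset.univ.erase i, ker₂ α i j := by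
  have h := translation_apply (ker₁ α i)
  have h2 : translation n (ker₁ α i) = 0 := by
    rw [ker₁, Derivation.leibniz, Derivation.prod_pow_eq_zero _ _ _ _ fun i _ => translation_lin i,
      Derivation.leibniz_pow, translation_lin]
    simp
  have h3 : ∑ j ∈ Finset.univ.erase i, pderiv j.succ (ker₁ α i) =
      - (C ((α : ℂ) + 1) * ∑ j ∈ Finset.univ.erase i, ker₂ α i j) := by
    rw [Finset.mul_sum, ← Finset.sum_neg_distrib]
    exact Finset.sum_congr rfl fun j hj => pderiv_ker₁ α (Finset.ne_of_mem_erase hj)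
  rw [h2, ← Finset.add_sum_erase _ _ (Finset.mem_univ i), h3] at h
  linear_combination -h

theorem subst_lin (i : Fin n) : subst (X i) (lin i) = 0 := by simp [lin]

theorem subst_ker (α : ℕ) (i : Fin n) : subst (X i) (ker n α) = 0 := by
  rw [ker_eq α i, map_mul, subst_lin, zero_mul]

theorem subst_ker₁ (α : ℕ) {i j : Fin n} (h : j ≠ i) : subst (X j) (ker₁ α i) = 0 := by
  rw [ker₁_eq α h, map_mul, subst_lin, zero_mul]

theorem subst_zero_ker (α : ℕ) : subst 0 (ker n α) =
    C ((-1) ^ ((α + 1) * n)) * ∏ i : Fin n, X i ^ (α + 1) := by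
  have : ∀ i : Fin n, (- X i : MvPolynomial (Fin n) ℂ) = C (-1) * X i := by simp
  simp only [ker, map_prod, map_pow, lin, map_sub, subst_X_zero, subst_X_succ, zero_sub, this,
    mul_pow, Finset.prod_mul_distrib]
  simp [pow_mul]

theorem sum_X_mul_ker (α : ℕ) :
    ∑ i : Fin n, X i.succ * (- pderiv i.succ (ker₁ α i) +
      C ((α : ℂ) + 1) * ∑ j ∈ Finset.univ.erase i, ker₂ α i j) =
    pderiv 0 (X 0 * ∑ i : Fin n, ker₁ α i - (n : MvPolynomial (Fin (n + 1)) ℂ) * ker n α) := by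
  have h1 : ∀ i : Fin n, X i.succ * (- pderiv i.succ (ker₁ α i) +
      C ((α : ℂ) + 1) * ∑ j ∈ Finset.univ.erase i, ker₂ α i j) =
      X 0 * pderiv 0 (ker₁ α i) + ker₁ α i - C ((α : ℂ) + 1) * ∑ j, ker₁ α j := by
    intro i
    have h2 : ∑ j, ker₁ α j = ker₁ α i + lin i * ∑ j ∈ Finset.univ.erase i, ker₂ α i j := by
      rw [← Finset.add_sum_erase _ _ (Finset.mem_univ i), Finset.mul_sum]
      congr 1
      refine Finset.sum_congr rfl fun j hj => ?_
      rw [ker₁_eq α (Finset.ne_of_mem_erase hj).symm, ker₂_comm]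
    have h3 : (X i.succ : MvPolynomial (Fin (n + 1)) ℂ) = X 0 - lin i := by rw [lin]; ring
    rw [pderiv_zero_ker₁, h2, h3]
    have := lin_mul_pderiv_ker₁ α i
    rw [C_add, C_1]
    linear_combination this
  rw [Finset.sum_congr rfl fun i _ => h1 i, map_sub, Derivation.leibniz, Derivation.leibniz,
    Derivation.map_natCast, pderiv_X_self, pderiv_zero_ker, map_sum, Finset.sum_sub_distrib,
    Finset.sum_add_distrib, ← Finset.mul_sum]
  simp

theorem exists_auxiliary (n α : ℕ) (hn : n ≠ 0) : ∃ w : MvPolynomial (Fin n) ℂ, w.IsSymmetric ∧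
    (∃ u : ℂ, u ≠ 0 ∧ lowering w = C u * ∏ i, X i ^ (α + 1)) ∧
    ∃ v : ℂ, DRel (((α + 1 : ℕ) : ℂ)⁻¹) (fun _ => ((α + 1 : ℕ) : ℂ)) w
      (C v * ∏ i, X i ^ (α + 1)) := by
  have ha : ((α : ℂ) + 1) ≠ 0 := Nat.cast_add_one_ne_zero α
  have hd : ∀ i, pderiv i (integral (ker n α)) = - (C ((α : ℂ) + 1) * integral (ker₁ α i)) := by
    intro i
    rw [pderiv_integral, subst_ker, pderiv_ker, ← neg_mul, ← C_neg, integral_C_mul, C_neg]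
    ring
  refine ⟨integral (ker n α), fun e => ?_, ⟨-(n * -(-1) ^ ((α + 1) * n)), ?_, ?_⟩,
    n ^ 2 * (-1) ^ ((α + 1) * n), ?_⟩
  · rw [rename_integral, ker, map_prod]
    congr 1
    refine (Finset.prod_congr rfl fun i _ => ?_).trans
      (Equiv.prod_comp e fun i => lin i ^ (α + 1))
    simp [lin]
  · simpa using hn
  · rw [lowering_apply, Finset.sum_congr rfl fun i _ => hd i, Finset.sum_neg_distrib,
      ← Finset.mul_sum, ← integral_sum, ← integral_C_mul, ← pderiv_zero_ker, integral_pderiv_zero]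
    simp only [subst_ker, subst_zero_ker, zero_sub]
    simp
    ring
  · refine ⟨fun i j => if i = j then 0 else - (C (((α : ℂ) + 1) ^ 2) * integral (ker₂ α i j)),
      by simp, fun i j => ?_, ?_⟩
    · dsimp only
      split_ifs with hij
      · subst hij; simp
      rw [hd, hd, ker₁_eq α (Ne.symm hij), ker₁_eq α hij, ker₂_comm α j i]
      have h (k : Fin n) (K : MvPolynomial (Fin (n + 1)) ℂ) :
          integral (lin k * K) = integral (X 0 * K) - X k * integral K := by
        rw [lin, sub_mul, integral_sub, integral_X_succ_mul]
      rw [h, h, Nat.cast_add_one]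
      simp only [C_pow]
      ring
    · have e1 : ∑ i : Fin n, ∑ j, (X i + X j) * (if i = j then 0 else
          - (C (((α : ℂ) + 1) ^ 2) * integral (ker₂ α i j))) = - (2 * C (((α : ℂ) + 1) ^ 2) *
          ∑ i : Fin n, X i * ∑ j ∈ Finset.univ.erase i, integral (ker₂ α i j)) := by
        have : ∀ i j : Fin n, (X i + X j) * (if i = j then 0 else
          - (C (((α : ℂ) + 1) ^ 2) * integral (ker₂ α i j))) =
          X i * (if i = j then 0 else - (C (((α : ℂ) + 1) ^ 2) * integral (ker₂ α i j))) +
          X j * (if j = i then 0 else - (C (((α : ℂ) + 1) ^ 2) * integral (ker₂ α j i))) := by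
          intro i j
          rw [ker₂_comm α j i]
          simp only [eq_comm (a := j) (b := i)]
          ring
        simp only [this, Finset.sum_add_distrib]
        rw [Finset.sum_comm (f := fun i j => X j * _), ← two_mul, mul_assoc, ← mul_neg,
          Finset.mul_sum _ _ (C _), ← Finset.sum_neg_distrib]
        congr 1
        refine Finset.sum_congr rfl fun i _ => ?_
        rw [← Finset.add_sum_erase _ _ (Finset.mem_univ i), if_pos rfl, mul_zero, zero_add,
          Finset.mul_sum, Finset.mul_sum, ← Finset.sum_neg_distrib]
        refine Finset.sum_congr rfl fun j hj => ?_
        rw [if_neg (Finset.ne_of_mem_erase hj).symm]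
        ring
      have e2 : ∑ i : Fin n, C (((α + 1 : ℕ) : ℂ))⁻¹ * X i *
          pderiv i (pderiv i (integral (ker n α))) =
          - ∑ i : Fin n, X i * (integral (pderiv i.succ (ker₁ α i)) + subst (X i) (ker₁ α i)) := by
        rw [← Finset.sum_neg_distrib]
        refine Finset.sum_congr rfl fun i _ => ?_
        have h2 : (C (((α + 1 : ℕ) : ℂ))⁻¹ * C ((α : ℂ) + 1) : MvPolynomial (Fin n) ℂ) = 1 := by
          rw [← C_mul, ← C_1]; congr 1; push_cast; exact inv_mul_cancel₀ ha
        rw [hd, map_neg, pderiv_C_mul, pderiv_integral]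
        linear_combination
          (- X i * (integral (pderiv i.succ (ker₁ α i)) + subst (X i) (ker₁ α i))) * h2
      have e3 := congrArg integral (sum_X_mul_ker (n := n) α)
      rw [integral_sum, integral_pderiv_zero] at e3
      have e4 : ∀ i : Fin n, integral (X i.succ * (- pderiv i.succ (ker₁ α i) +
          C ((α : ℂ) + 1) * ∑ j ∈ Finset.univ.erase i, ker₂ α i j)) =
          - (X i * integral (pderiv i.succ (ker₁ α i))) +
          C ((α : ℂ) + 1) * (X i * ∑ j ∈ Finset.univ.erase i, integral (ker₂ α i j)) := by
        intro i
        rw [integral_X_succ_mul, neg_add_eq_sub, integral_sub, integral_C_mul, integral_sum]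
        ring
      have e5 : ∀ m : Fin n, subst (X m) (X 0 * ∑ i : Fin n, ker₁ α i -
          (n : MvPolynomial (Fin (n + 1)) ℂ) * ker n α) = X m * subst (X m) (ker₁ α m) := by
        intro m
        rw [map_sub, map_mul, map_mul, subst_ker, mul_zero, sub_zero, subst_X_zero, map_sum,
          Finset.sum_eq_single m]
        · exact fun i _ hi => subst_ker₁ α hi.symm
        · simp
      have e6 : subst 0 (X 0 * ∑ i : Fin n, ker₁ α i -
          (n : MvPolynomial (Fin (n + 1)) ℂ) * ker n α) =
          - ((n : MvPolynomial (Fin n) ℂ) * subst 0 (ker n α)) := by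
        rw [map_sub, map_mul, map_mul, subst_X_zero, map_natCast]; ring
      simp only [e4, e5, e6, Finset.sum_sub_distrib, Finset.sum_add_distrib,
        Finset.sum_neg_distrib, ← Finset.mul_sum] at e3
      rw [e1, e2]
      have h2 : (C (((α + 1 : ℕ) : ℂ)⁻¹ / 2) * (2 * C (((α : ℂ) + 1) ^ 2)) :
          MvPolynomial (Fin n) ℂ) = C ((α : ℂ) + 1) := by
        rw [← map_ofNat C 2, ← C_mul, ← C_mul]; congr 1; push_cast; field_simp
      have h3 : (C ((n : ℂ) ^ 2 * (-1) ^ ((α + 1) * n)) * ∏ i : Fin n, X i ^ (α + 1)) =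
          (n : MvPolynomial (Fin n) ℂ) ^ 2 * subst 0 (ker n α) := by
        rw [subst_zero_ker, C_mul, C_pow, map_natCast, mul_assoc]
      rw [h3]
      simp only [mul_add, Finset.sum_add_distrib]
      simp only [Finset.sum_const, Finset.card_univ, Fintype.card_fin, nsmul_eq_mul] at e3
      linear_combination -e3 - (∑ i : Fin n, X i *
        ∑ j ∈ Finset.univ.erase i, integral (ker₂ α i j)) * h2

end Kernel

theorem finSuccEquiv_rename_cons {n : ℕ} (e : Equiv.Perm (Fin n))
    (f : MvPolynomial (Fin (n + 1)) ℂ) :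
    finSuccEquiv ℂ n (rename (Fin.cons 0 (Fin.succ ∘ e) : Fin (n + 1) → Fin (n + 1)) f) =
      (finSuccEquiv ℂ n f).map (rename e).toRingHom := by
  induction f using finSucc_induction with
  | add F G hF hG => simp only [map_add, hF, hG, Polynomial.map_add]
  | mono f s =>
    have : rename (Fin.cons 0 (Fin.succ ∘ e) : Fin (n + 1) → Fin (n + 1))
        (rename Fin.succ f * X 0 ^ s) = rename Fin.succ (rename e f) * X 0 ^ s := by
      rw [map_mul, map_pow, rename_X, rename_rename, rename_rename]
      rfl
    rw [this, map_mul, map_mul, finSuccEquiv_rename_succ, finSuccEquiv_rename_succ]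
    simp [finSuccEquiv_X_zero]

theorem isSymmetric_coeff_finSuccEquiv {n : ℕ} {f : MvPolynomial (Fin (n + 1)) ℂ}
    (hf : f.IsSymmetric) (t : ℕ) : ((finSuccEquiv ℂ n f).coeff t).IsSymmetric := fun e => by
  have h := finSuccEquiv_rename_cons e f
  have he : (Fin.cons 0 (Fin.succ ∘ e) : Fin (n + 1) → Fin (n + 1)) =
      Equiv.Perm.decomposeFin.symm (0, e) := by
    funext i
    refine Fin.cases ?_ (fun i => ?_) i <;> simp
  rw [he, hf] at h
  have := congrArg (fun p => p.coeff t) h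
  simpa using this.symm

theorem eq_zero_of_lowering_eq {n α : ℕ} {h : MvPolynomial (Fin (n + 1)) ℂ} (hs : h.IsSymmetric)
    (hd : (finSuccEquiv ℂ n h).natDegree ≤ α) {u : ℂ}
    (hl : lowering h = C u * ∏ i, X i ^ α) : u = 0 := by
  have hdeg (i : Fin (n + 1)) : degreeOf i h ≤ α := by
    rw [natDegree_finSuccEquiv] at hd
    have := degreeOf_rename_of_injective (p := h) (Equiv.swap 0 i).injective 0
    rw [hs, Equiv.swap_apply_left] at this
    rwa [this]
  have hm : (∏ i, X i ^ α : MvPolynomial (Fin (n + 1)) ℂ) =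
      monomial (Finsupp.equivFunOnFinite.symm fun _ => α) 1 := by
    rw [monomial_eq, Finsupp.prod_fintype _ _ (by simp)]
    simp
  have := congrArg (coeff (Finsupp.equivFunOnFinite.symm fun _ => α)) hl
  rw [hm, coeff_C_mul, coeff_monomial, if_pos rfl, mul_one, lowering_apply, coeff_sum] at this
  rw [← this]
  refine Finset.sum_eq_zero fun i _ => ?_
  rw [coeff_pderiv]
  convert zero_mul _
  by_contra h0
  have h1 := monomial_le_degreeOf i (mem_support_iff.2 h0)
  have h2 := hdeg i
  simp at h1
  omega

theorem const_eq_cons {n : ℕ} (x : ℂ) : (fun _ : Fin (n + 1) => x) = Fin.cons x fun _ => x := by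
  funext i
  refine Fin.cases ?_ (fun i => ?_) i <;> simp

theorem finSuccEquiv_prod_X_pow (n α : ℕ) :
    finSuccEquiv ℂ n (∏ i, X i ^ α) = Polynomial.C (∏ i, X i ^ α) * Polynomial.X ^ α := by
  rw [Fin.prod_univ_succ, map_mul, map_pow, finSuccEquiv_X_zero, map_prod, map_prod, mul_comm]
  simp [finSuccEquiv_X_succ]

theorem ne_zero_of_leadingCoeff_eq_C {n : ℕ} {f : MvPolynomial (Fin (n + 1)) ℂ}
    (h : f ≠ 0) {x : ℂ} (hx : (finSuccEquiv ℂ n f).leadingCoeff = C x) : x ≠ 0 := by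
  rintro rfl
  rw [C_0, Polynomial.leadingCoeff_eq_zero, map_eq_zero_iff _ (finSuccEquiv ℂ n).injective] at hx
  exact h hx

theorem natDegree_le_or {n α : ℕ}
    (ih : ∀ f : MvPolynomial (Fin (n + 1)) ℂ, f.IsSymmetric →
      Lowest (((α + 1 : ℕ) : ℂ)⁻¹) (fun _ => ((α + 1 : ℕ) : ℂ)) f → ∃ x, f = C x)
    {h : MvPolynomial (Fin (n + 2)) ℂ} (hs : h.IsSymmetric) {u v : ℂ}
    (hl : lowering h = C u * ∏ i, X i ^ (α + 1))
    (hD : DRel (((α + 1 : ℕ) : ℂ)⁻¹) (fun _ => ((α + 1 : ℕ) : ℂ)) h (C v * ∏ i, X i ^ (α + 1))) :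
    (finSuccEquiv ℂ _ h).natDegree ≤ α + 1 ∨
      (finSuccEquiv ℂ _ h).natDegree = 1 + (α + 1) * (n + 2) ∧
        ∃ x, x ≠ 0 ∧ (finSuccEquiv ℂ _ h).leadingCoeff = C x := by
  rw [or_iff_not_imp_left, not_le]
  intro hd
  have ha : ((α + 1 : ℕ) : ℂ) ≠ 0 := Nat.cast_ne_zero.2 α.succ_ne_zero
  rw [const_eq_cons] at hD
  have hc (x : ℂ) : (finSuccEquiv ℂ (n + 1) (C x * ∏ i, X i ^ (α + 1))).coeff
      (finSuccEquiv ℂ _ h).natDegree = 0 := by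
    have : finSuccEquiv ℂ (n + 1) (C x) = Polynomial.C (C x) := by simp [finSuccEquiv_apply]
    rw [map_mul, finSuccEquiv_prod_X_pow, this, Polynomial.coeff_C_mul, Polynomial.coeff_C_mul,
      Polynomial.coeff_X_pow, if_neg hd.ne', mul_zero, mul_zero]
  obtain ⟨x, hx⟩ := ih _ (isSymmetric_coeff_finSuccEquiv hs _)
    (Lowest.of_coeff hD (by rw [hl, hc]) (hc v))
  have hx0 : x ≠ 0 := ne_zero_of_leadingCoeff_eq_C (by rintro rfl; simp at hd) hx
  have hp (x : ℂ) : pureZero (n + 1) (C x * ∏ i, X i ^ (α + 1)) = 0 := by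
    rw [map_mul, Fin.prod_univ_succ, Fin.prod_univ_succ, map_mul, map_mul, map_pow (pureZero _),
      map_pow (pureZero _), pureZero_X_succ]
    simp
  refine ⟨?_, x, hx0, hx⟩
  obtain h0 | h0 := hD.eq_zero_or_degree_eq ha (hp v) (by rw [hl, hp])
    (t := (finSuccEquiv ℂ _ h).natDegree) (by
      rw [show (finSuccEquiv ℂ _ h).coeff _ = C x from hx]; simpa using hx0)
  · omega
  · rw [inv_mul_cancel₀ ha, one_mul] at h0
    have : ((finSuccEquiv ℂ _ h).natDegree : ℂ) = ((1 + (α + 1) * (n + 2) : ℕ) : ℂ) := by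
      simp at h0
      push_cast
      linear_combination h0
    exact_mod_cast this

theorem exists_eq_C_of_isSymmetric_of_lowest (α : ℕ) : ∀ (n : ℕ) (f : MvPolynomial (Fin n) ℂ),
    f.IsSymmetric → Lowest (((α + 1 : ℕ) : ℂ)⁻¹) (fun _ => ((α + 1 : ℕ) : ℂ)) f → ∃ x, f = C x
  | 0, f, _, _ => ⟨_, eq_C_of_isEmpty f⟩
  | 1, f, _, hf => by
    refine ⟨_, eq_C_of_natDegree_eq_zero (eq_C_of_isEmpty _) ?_⟩
    have h := hf.1
    rw [lowering_apply, Fin.sum_univ_succ, Finset.univ_eq_empty, Finset.sum_empty, add_zero] at h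
    have h2 := finSuccEquiv_pderiv_zero f
    rw [h, map_zero] at h2
    exact Polynomial.derivative_eq_zero.1 h2.symm
  | n + 2, f, hs, hf => by
    have ih := exists_eq_C_of_isSymmetric_of_lowest α (n + 1)
    have ha : ((α + 1 : ℕ) : ℂ) ≠ 0 := Nat.cast_ne_zero.2 α.succ_ne_zero
    have hf' := hf
    rw [const_eq_cons] at hf'
    obtain ⟨x, hx⟩ := ih (finSuccEquiv ℂ _ f).leadingCoeff (isSymmetric_coeff_finSuccEquiv hs _) hf'.leadingCoeff
    refine ⟨x, (hf'.const_or_degree_eq ha hx).resolve_right fun hd => ?_⟩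
    have hd' : (finSuccEquiv ℂ _ f).natDegree = 1 + (α + 1) * (n + 2) := by
      rw [inv_mul_cancel₀ ha, one_mul] at hd
      have : ((finSuccEquiv ℂ _ f).natDegree : ℂ) = ((1 + (α + 1) * (n + 2) : ℕ) : ℂ) := by
        simp at hd
        push_cast
        linear_combination hd
      exact_mod_cast this
    have hx0 : x ≠ 0 := ne_zero_of_leadingCoeff_eq_C (by rintro rfl; simp at hd') hx
    obtain ⟨w, ws, ⟨u, hu, wl⟩, v, wD⟩ := exists_auxiliary (n + 2) α (by omega)
    obtain hw | ⟨hwd, y, hy, hwy⟩ := natDegree_le_or ih ws wl wD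
    · exact hu (eq_zero_of_lowering_eq ws hw wl)
    have hC (z : ℂ) : finSuccEquiv ℂ (n + 1) (C z) = Polynomial.C (C z) := by
      simp [finSuccEquiv_apply]
    have hlow (z : ℂ) (g : MvPolynomial (Fin (n + 2)) ℂ) :
        lowering (C z * g) = C z * lowering g := by
      rw [← smul_eq_C_mul, map_smul, smul_eq_C_mul]
    have gs : (C x * w + C (-y) * f).IsSymmetric := fun e => by
      rw [map_add, map_mul, map_mul, rename_C, rename_C, ws, hs]
    have gl : lowering (C x * w + C (-y) * f) = C (x * u) * ∏ i, X i ^ (α + 1) := by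
      rw [map_add, hlow, hlow, hf.1, wl, C_mul]; ring
    have gD := (wD.const_mul x).add (hf.2.const_mul (-y))
    rw [mul_zero, add_zero, ← mul_assoc, ← C_mul] at gD
    have gdeg : (finSuccEquiv ℂ _ (C x * w + C (-y) * f)).natDegree < 1 + (α + 1) * (n + 2) := by
      rw [map_add, map_mul, map_mul, hC, hC]
      refine lt_of_le_of_ne ?_ fun h => ?_
      · refine (Polynomial.natDegree_add_le _ _).trans (max_le ?_ ?_)
        · exact (Polynomial.natDegree_C_mul_le _ _).trans hwd.le
        · exact (Polynomial.natDegree_C_mul_le _ _).trans hd'.le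
      · rw [Polynomial.leadingCoeff, hwd] at hwy
        have hx := hx
        rw [Polynomial.leadingCoeff, hd'] at hx
        have h2 : (Polynomial.C (C x) * finSuccEquiv ℂ _ w +
          Polynomial.C (C (-y)) * finSuccEquiv ℂ _ f).leadingCoeff = 0 := by
          rw [Polynomial.leadingCoeff, h, Polynomial.coeff_add, Polynomial.coeff_C_mul,
            Polynomial.coeff_C_mul, hwy, hx, ← C_mul, ← C_mul, ← C_add]
          convert C_0
          ring
        rw [Polynomial.leadingCoeff_eq_zero] at h2
        rw [h2] at h
        simp at h
    obtain hg | hg := natDegree_le_or ih gs gl gD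
    · exact mul_ne_zero hx0 hu (eq_zero_of_lowering_eq gs hg gl)
    · exact gdeg.ne hg.1

/-- The coproduct on the ring of power sums, splitting off one variable of weight `g`. -/
noncomputable def split (g : ℂ) : MvPolynomial ℕ ℂ →ₐ[ℂ] Polynomial (MvPolynomial ℕ ℂ) :=
  aeval fun r => Polynomial.C (X r) + Polynomial.C (C g) * Polynomial.X ^ r

theorem split_X (g : ℂ) (r : ℕ) : split g (X r) =
    Polynomial.C (X r) + Polynomial.C (C g) * Polynomial.X ^ r := by simp [split]

theorem split_C (g x : ℂ) : split g (C x) = Polynomial.C (C x) := by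
  rw [split, aeval_C]; rfl

/-- The coefficients of the coproduct `split`. -/
noncomputable def part (g : ℂ) (t : ℕ) (φ : MvPolynomial ℕ ℂ) : MvPolynomial ℕ ℂ :=
  (split g φ).coeff t

theorem part_add (g : ℂ) (t : ℕ) (φ ψ : MvPolynomial ℕ ℂ) :
    part g t (φ + ψ) = part g t φ + part g t ψ := by simp [part]

theorem part_C (g : ℂ) (t : ℕ) (x : ℂ) : part g t (C x) = if t = 0 then C x else 0 := by
  rw [part, split_C, Polynomial.coeff_C]

theorem part_zero_right (g : ℂ) (t : ℕ) : part g t 0 = 0 := by simp [part]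

theorem part_C_mul (g : ℂ) (t : ℕ) (x : ℂ) (φ : MvPolynomial ℕ ℂ) :
    part g t (C x * φ) = C x * part g t φ := by
  rw [part, map_mul, split_C, Polynomial.coeff_C_mul, part]

theorem part_mul_X (g : ℂ) (t r : ℕ) (φ : MvPolynomial ℕ ℂ) :
    part g t (φ * X r) = part g t φ * X r + C g * if r ≤ t then part g (t - r) φ else 0 := by
  simp only [part, map_mul, split_X, mul_add, Polynomial.coeff_add, Polynomial.coeff_mul_C,
    mul_comm (split g φ) (_ * _), mul_assoc, Polynomial.coeff_C_mul, Polynomial.coeff_X_pow_mul']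

theorem part_comm (g h : ℂ) (φ : MvPolynomial ℕ ℂ) : ∀ s t : ℕ,
    part g s (part h t φ) = part h t (part g s φ) := by
  induction φ using MvPolynomial.induction_on with
  | C x =>
    intro s t
    simp only [part_C]
    split_ifs <;> simp_all [part_C, part_zero_right]
  | add p q hp hq => intro s t; simp only [part_add, hp, hq]
  | mul_X p r hp =>
    intro s t
    simp only [part_mul_X, part_add, part_C_mul, hp]
    split_ifs <;> simp only [hp, part_zero_right] <;> ring

theorem coeff_eval₂_X {R : Type*} [CommRing R] (f : R →+* Polynomial R) (p : Polynomial R)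
    (T : ℕ) : (p.eval₂ f Polynomial.X).coeff T =
      ∑ t ∈ Finset.range (T + 1), (f (p.coeff t)).coeff (T - t) := by
  induction p using Polynomial.induction_on' with
  | add p q hp hq =>
    simp only [Polynomial.eval₂_add, Polynomial.coeff_add, hp, hq, map_add, Finset.sum_add_distrib]
  | monomial n a =>
    rw [Polynomial.eval₂_monomial, Polynomial.coeff_mul_X_pow']
    split_ifs with h
    · rw [Finset.sum_eq_single n]
      · simp
      · intro t _ ht
        simp [Polynomial.coeff_monomial, ht.symm]
      · simp [h]
    · refine (Finset.sum_eq_zero fun t ht => ?_).symm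
      rw [Polynomial.coeff_monomial, if_neg (by rw [Finset.mem_range] at ht; omega)]
      simp

theorem part_add_left (g h : ℂ) (T : ℕ) (φ : MvPolynomial ℕ ℂ) :
    part (g + h) T φ = ∑ t ∈ Finset.range (T + 1), part g (T - t) (part h t φ) := by
  have : split (g + h) φ = (split h φ).eval₂ (split g).toRingHom Polynomial.X := by
    induction φ using MvPolynomial.induction_on with
    | C x => simp
    | add p q hp hq => simp [hp, hq]
    | mul_X p r hp =>
      rw [map_mul, map_mul, Polynomial.eval₂_mul, hp, split_X, split_X]
      simp [split_X]
      exact .inl (by ring)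
  rw [part, this, coeff_eval₂_X]
  rfl

theorem part_zero (t : ℕ) (φ : MvPolynomial ℕ ℂ) : part 0 t φ = if t = 0 then φ else 0 := by
  have : split 0 φ = Polynomial.C φ := by
    induction φ using MvPolynomial.induction_on with
    | C x => simp
    | add p q hp hq => simp [hp, hq]
    | mul_X p r hp => simp [hp, split_X]
  rw [part, this, Polynomial.coeff_C]

theorem coeff_finSuccEquiv_ev_cons {m : ℕ} (g : ℂ) (γ : Fin m → ℂ) (φ : MvPolynomial ℕ ℂ) (t : ℕ) :
    (finSuccEquiv ℂ m (ev (Fin.cons g γ) φ)).coeff t = ev γ (part g t φ) := by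
  have : finSuccEquiv ℂ m (ev (Fin.cons g γ) φ) = (split g φ).map (ev γ).toRingHom := by
    have hC (x : ℂ) : finSuccEquiv ℂ m (C x) = Polynomial.C (C x) := by simp [finSuccEquiv_apply]
    induction φ using MvPolynomial.induction_on with
    | C x => simp [hC]
    | add p q hp hq => simp [hp, hq]
    | mul_X p r hp =>
      rw [map_mul, map_mul, map_mul, Polynomial.map_mul, hp, split_X, ev_X, Fin.sum_univ_succ]
      simp [hC, finSuccEquiv_X_zero, finSuccEquiv_X_succ]
      exact .inl (by ring)
  rw [this, Polynomial.coeff_map]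
  rfl

theorem ev_cons_eq_zero_iff {m : ℕ} (g : ℂ) (γ : Fin m → ℂ) (φ : MvPolynomial ℕ ℂ) :
    ev (Fin.cons g γ) φ = 0 ↔ ∀ t, ev γ (part g t φ) = 0 := by
  simp only [← coeff_finSuccEquiv_ev_cons]
  rw [← map_eq_zero_iff _ (finSuccEquiv ℂ m).injective, Polynomial.ext_iff]
  simp

/-- Weights `1` for `p` variables and `a` for `ν` variables. -/
def weight (a : ℂ) (ν : ℕ) : ∀ p : ℕ, Fin (ν + p) → ℂ
  | 0 => fun _ => a
  | p + 1 => Fin.cons (1 : ℂ) (weight a ν p)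

/-- Vanishing of `φ` on the power sums of `p` variables of weight `1` and `ν` of weight `a`. -/
def Vanishes (a : ℂ) (ν p : ℕ) (φ : MvPolynomial ℕ ℂ) : Prop := ev (weight a ν p) φ = 0

/-- The coefficients of index at least `E` of `φ` in a variable of weight `1` vanish. -/
def DegreeLT (a : ℂ) (ν p E : ℕ) (φ : MvPolynomial ℕ ℂ) : Prop :=
  ∀ t, E ≤ t → Vanishes a ν p (part 1 t φ)

section

variable {a : ℂ} {ν p E : ℕ} {φ ψ : MvPolynomial ℕ ℂ}

theorem vanishes_succ : Vanishes a ν (p + 1) φ ↔ ∀ t, Vanishes a ν p (part 1 t φ) :=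
  ev_cons_eq_zero_iff _ _ _

theorem Vanishes.part_weight (h : Vanishes a (ν + 1) 0 φ) (t : ℕ) :
    Vanishes a ν 0 (part a t φ) := by
  have h' : ev (fun _ : Fin (ν + 1) => a) φ = 0 := h
  rw [const_eq_cons, ev_cons_eq_zero_iff] at h'
  exact h' t

theorem Vanishes.zero : Vanishes a ν p 0 := map_zero _

theorem Vanishes.add (h : Vanishes a ν p φ) (h' : Vanishes a ν p ψ) : Vanishes a ν p (φ + ψ) := by
  rw [Vanishes, map_add, h, h', add_zero]

theorem Vanishes.sub (h : Vanishes a ν p φ) (h' : Vanishes a ν p ψ) : Vanishes a ν p (φ - ψ) := by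
  rw [Vanishes, map_sub, h, h', sub_zero]

theorem Vanishes.sum {ι : Type*} {s : Finset ι} {f : ι → MvPolynomial ℕ ℂ}
    (h : ∀ i ∈ s, Vanishes a ν p (f i)) : Vanishes a ν p (∑ i ∈ s, f i) := by
  rw [Vanishes, map_sum]
  exact Finset.sum_eq_zero h

theorem DegreeLT.part (h : DegreeLT a ν (p + 1) E φ) (s : ℕ) :
    DegreeLT a ν p E (part 1 s φ) := fun t ht => by
  rw [part_comm]
  exact vanishes_succ.1 (h t ht) s

theorem part_iterate_comm (r s : ℕ) (φ : MvPolynomial ℕ ℂ) :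
    part 1 s ((part 1 E)^[r] φ) = (part 1 E)^[r] (part 1 s φ) := by
  induction r generalizing φ with
  | zero => rfl
  | succ r ih => rw [Function.iterate_succ_apply, ih, part_comm, ← Function.iterate_succ_apply]

theorem Vanishes.iterate {r : ℕ} (h : Vanishes a ν (p + r) φ) :
    Vanishes a ν p ((FoulkesHowe.part 1 E)^[r] φ) := by
  induction r generalizing φ with
  | zero => exact h
  | succ r ih => exact ih (vanishes_succ.1 h E)

/-- Merging variables of weight `1`. -/
theorem Vanishes.part_natCast (h : Vanishes a ν p φ) (t : ℕ) :
    Vanishes a ν 0 (FoulkesHowe.part p t φ) := by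
  induction p generalizing φ t with
  | zero =>
    rw [Nat.cast_zero, part_zero]
    split_ifs
    exacts [h, .zero]
  | succ p ih =>
    rw [Nat.cast_succ, part_add_left]
    exact Vanishes.sum fun s _ => ih (vanishes_succ.1 h s) _

theorem DegreeLT.merge (h : DegreeLT a ν p (E + 1) φ) :
    (∀ T, (p + 1) * E < T → Vanishes a ν 0 (FoulkesHowe.part (p + 1 : ℕ) T φ)) ∧
      Vanishes a ν 0 (FoulkesHowe.part (p + 1 : ℕ) ((p + 1) * E) φ -
        (FoulkesHowe.part 1 E)^[p + 1] φ) := by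
  induction p generalizing φ with
  | zero =>
    refine ⟨fun T hT => ?_, ?_⟩
    · rw [Nat.zero_add, Nat.cast_one]; exact h T (by omega)
    · rw [Nat.zero_add, Nat.cast_one, one_mul, Function.iterate_one, sub_self]; exact .zero
  | succ p ih =>
    have key : ∀ T t, (p + 2) * E ≤ T → (t ≠ E ∨ (p + 2) * E < T) → Vanishes a ν 0
        (FoulkesHowe.part (p + 1 : ℕ) (T - t) (FoulkesHowe.part 1 t φ)) := by
      intro T t hT ht
      rcases lt_or_ge E t with hE | hE
      · exact Vanishes.part_natCast (h t hE) _
      · refine (ih (h.part t)).1 _ ?_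
        have : (p + 2) * E = (p + 1) * E + E := by ring
        omega
    refine ⟨fun T hT => ?_, ?_⟩
    · rw [Nat.cast_succ, part_add_left]
      exact Vanishes.sum fun t _ => key _ _ hT.le (.inr hT)
    · rw [Nat.cast_succ, part_add_left, Function.iterate_succ_apply,
        ← Finset.add_sum_erase _ _ (Finset.mem_range.2 (show E < (p + 2) * E + 1 by nlinarith)),
        add_sub_right_comm, show (p + 2) * E - E = (p + 1) * E by
          rw [show (p + 2) * E = (p + 1) * E + E by ring, Nat.add_sub_cancel]]
      exact (ih (h.part E)).2.add <| Vanishes.sum fun t ht =>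
        key _ _ le_rfl (.inl (Finset.ne_of_mem_erase ht))

theorem Vanishes.iterate_of_degreeLT {α : ℕ} (h : Vanishes (α + 1 : ℕ) (ν + 1) p φ)
    (hd : DegreeLT (α + 1 : ℕ) ν (p + α) (E + 1) φ) :
    Vanishes (α + 1 : ℕ) ν p ((FoulkesHowe.part 1 E)^[α + 1] φ) := by
  induction p generalizing φ with
  | zero =>
    rw [Nat.zero_add] at hd
    simpa using (h.part_weight ((α + 1) * E)).sub hd.merge.2
  | succ p ih =>
    refine vanishes_succ.2 fun s => ?_
    rw [part_iterate_comm]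
    rw [Nat.add_right_comm] at hd
    exact ih (vanishes_succ.1 h s) (hd.part s)

theorem vanishes_extend {q : ℕ} (H : ∀ φ, Vanishes a (ν + 1) p φ →
    DegreeLT a ν q E φ → Vanishes a ν (q + 1) φ) {j : ℕ} (h : Vanishes a (ν + 1) (p + j) φ)
    (hd : DegreeLT a ν (q + j) E φ) : Vanishes a ν (q + j + 1) φ := by
  induction j generalizing φ with
  | zero => exact H φ h hd
  | succ j ih => exact vanishes_succ.2 fun s => ih (vanishes_succ.1 h s) (hd.part s)

end

theorem isSymmetric_ev_const {n : ℕ} (a : ℂ) (φ : MvPolynomial ℕ ℂ) :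
    (ev (fun _ : Fin n => a) φ).IsSymmetric := fun e => by
  induction φ using MvPolynomial.induction_on with
  | C x => simp
  | add p q hp hq => rw [map_add, map_add, hp, hq]
  | mul_X p r hp =>
    rw [map_mul, map_mul, hp, ev_X, map_sum]
    simp only [map_mul, map_pow, rename_X, rename_C]
    rw [Equiv.sum_comp e fun i => C a * X i ^ r]

theorem constantCoeff_ev_eq {m n : ℕ} {γ : Fin m → ℂ} {η : Fin n → ℂ} (h : ∑ i, γ i = ∑ i, η i)
    (φ : MvPolynomial ℕ ℂ) : constantCoeff (ev γ φ) = constantCoeff (ev η φ) := by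
  induction φ using MvPolynomial.induction_on with
  | C x => simp
  | add p q hp hq => rw [map_add, map_add, map_add, map_add, hp, hq]
  | mul_X p r hp =>
    rw [map_mul, map_mul, map_mul, map_mul, hp, ev_X, ev_X, map_sum, map_sum]
    simp [← Finset.sum_mul, h]

theorem sum_weight (a : ℂ) (ν p : ℕ) : ∑ i, weight a ν p i = a * ν + p := by
  induction p with
  | zero => simp [weight, mul_comm]
  | succ p ih =>
    have : ∑ i, weight a ν (p + 1) i = 1 + ∑ i, weight a ν p i :=
      (Fin.sum_univ_succ (n := ν + p) (weight a ν (p + 1))).trans rfl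
    rw [this, ih]; push_cast; ring

theorem weight_ne_zero {a : ℂ} (ha : a ≠ 0) (ν p : ℕ) (i) : weight a ν p i ≠ 0 := by
  induction p with
  | zero => exact ha
  | succ p ih => exact Fin.cases (motive := fun i => weight a ν (p + 1) i ≠ 0) one_ne_zero ih i

theorem weight_eq {a : ℂ} (ha : a ≠ 0) (ν p : ℕ) (i) :
    1 + a⁻¹ * weight a ν p i ^ 2 = (1 + a⁻¹) * weight a ν p i := by
  induction p with
  | zero => simp only [weight]; field_simp; ring
  | succ p ih =>
    refine Fin.cases (motive := fun i => 1 + a⁻¹ * weight a ν (p + 1) i ^ 2 =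
      (1 + a⁻¹) * weight a ν (p + 1) i) ?_ ih i
    simp [weight]

theorem lowest_const {α ν p : ℕ} (hp : p ≤ α) {φ : MvPolynomial ℕ ℂ}
    (h : Lowest (((α + 1 : ℕ) : ℂ)⁻¹) (weight (α + 1 : ℕ) ν p) (ev (weight (α + 1 : ℕ) ν p) φ)) :
    ∃ x, ev (weight (α + 1 : ℕ) ν p) φ = C x := by
  induction p generalizing φ with
  | zero => exact exists_eq_C_of_isSymmetric_of_lowest α _ _ (isSymmetric_ev_const _ φ) h
  | succ p ih =>
    have ha : ((α + 1 : ℕ) : ℂ) ≠ 0 := Nat.cast_ne_zero.2 α.succ_ne_zero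
    have hl := Lowest.leadingCoeff h
    have he := coeff_finSuccEquiv_ev_cons 1 (weight (α + 1 : ℕ) ν p) φ
    obtain ⟨x, hx⟩ := ih (by omega) (φ := part 1 _ φ) (by rw [← he]; exact hl)
    rw [← he] at hx
    refine ⟨x, (Lowest.const_or_degree_eq (m := ν + p) one_ne_zero h hx).resolve_right fun hd => ?_⟩
    rw [sum_weight, mul_one] at hd
    set g := (finSuccEquiv ℂ (ν + p) (ev (weight (α + 1 : ℕ) ν (p + 1)) φ)).natDegree
    have h1 : (α + 1) * g = (α + 1) * (ν + 1) + (p + 1) := by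
      have : (((α + 1) * g : ℕ) : ℂ) = (((α + 1) * (ν + 1) + (p + 1) : ℕ) : ℂ) := by
        field_simp at hd
        push_cast at hd ⊢
        linear_combination hd
      exact_mod_cast this
    have h2 : (α + 1) ∣ p + 1 := (Nat.dvd_add_right (Dvd.intro _ rfl)).1 (Dvd.intro _ h1)
    have := Nat.le_of_dvd p.succ_pos h2
    omega

theorem degreeLT_iff {a : ℂ} {ν p E : ℕ} {φ : MvPolynomial ℕ ℂ} : DegreeLT a ν p E φ ↔
    ∀ t, E ≤ t → (finSuccEquiv ℂ (ν + p) (ev (weight a ν (p + 1)) φ)).coeff t = 0 :=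
  forall₂_congr fun t _ => by
    rw [weight, coeff_finSuccEquiv_ev_cons]; rfl

theorem totalDegree_lowering_add_one_le {m : ℕ} {f : MvPolynomial (Fin m) ℂ} (h : lowering f ≠ 0) :
    (lowering f).totalDegree + 1 ≤ f.totalDegree := by
  rw [lowering_apply] at h ⊢
  obtain ⟨i, -, hi⟩ := Finset.exists_ne_zero_of_sum_ne_zero h
  have h1 := totalDegree_pderiv_add_one_le hi
  have : (∑ i, pderiv i f).totalDegree ≤ f.totalDegree - 1 := by
    refine totalDegree_finsetSum_le fun j _ => ?_
    by_cases hj : pderiv j f = 0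
    · simp [hj]
    · have := totalDegree_pderiv_add_one_le hj; omega
  omega

theorem vanishes_of_vanishes_zero {α k : ℕ} {φ : MvPolynomial ℕ ℂ}
    (h : Vanishes (α + 1 : ℕ) (k + 1) 0 φ) (hd : DegreeLT (α + 1 : ℕ) k α (k + 2) φ) :
    Vanishes (α + 1 : ℕ) k (α + 1) φ := by
  have ha : ((α + 1 : ℕ) : ℂ) ≠ 0 := Nat.cast_ne_zero.2 α.succ_ne_zero
  induction hN : (ev (weight (α + 1 : ℕ) k (α + 1)) φ).totalDegree using Nat.strong_induction_on
    generalizing φ with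
  | _ N ih =>
  rw [degreeLT_iff] at hd
  set f := ev (weight (α + 1 : ℕ) k (α + 1)) φ with hf
  obtain ⟨ψ, hψ⟩ := exists_lowering φ
  obtain ⟨θ, hθ⟩ := exists_DRel (((α + 1 : ℕ) : ℂ)⁻¹) φ
  have hl : lowering f = 0 := by
    by_contra h0
    have hlt := totalDegree_lowering_add_one_le h0
    rw [hψ] at h0 hlt
    refine h0 (ih _ (by omega) ?_ (degreeLT_iff.2 fun t ht => ?_) rfl)
    · rw [Vanishes, ← hψ, h, map_zero]
    · rw [← hψ, ← hf, coeff_lowering, hd t ht, hd (t + 1) (by omega), map_zero, zero_mul, add_zero]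
  have hD := hθ _ _ (weight_ne_zero ha k (α + 1)) (weight_eq ha k (α + 1))
  have hD0 : ev (weight (α + 1 : ℕ) k (α + 1)) θ = 0 := by
    by_contra h0
    have hlt := hD.totalDegree_add_one_le h0
    rw [← hf] at hlt
    refine h0 (ih _ (by omega) ?_ (degreeLT_iff.2 fun t ht => ?_) rfl)
    · have := hθ _ _ (weight_ne_zero ha (k + 1) 0) (weight_eq ha (k + 1) 0)
      rw [h] at this
      exact this.unique .zero
    · have h1 := DRel.coeff (m := k + α) hD (t := t) (Polynomial.natDegree_le_iff_coeff_eq_zero.2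
        fun s hs => hd s (by omega))
      rw [← hf, hd t ht, map_zero, mul_zero, sub_zero] at h1
      exact h1.unique .zero
  rw [hD0] at hD
  have hL : Lowest (((α + 1 : ℕ) : ℂ)⁻¹) (Fin.cons 1 (weight (α + 1 : ℕ) k α)) f := ⟨hl, hD⟩
  have hlc := hL.leadingCoeff
  have he := coeff_finSuccEquiv_ev_cons 1 (weight (α + 1 : ℕ) k α) φ
  obtain ⟨x, hx⟩ := lowest_const le_rfl (φ := part 1 _ φ) (by rw [← he]; exact hlc)
  rw [← he] at hx
  have hfx : f = C x := (hL.const_or_degree_eq one_ne_zero hx).resolve_right fun hg => by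
    rw [sum_weight, mul_one] at hg
    have hg' : (finSuccEquiv ℂ (k + α) f).natDegree = k + 2 := by
      have : ((finSuccEquiv ℂ (k + α) f).natDegree : ℂ) = ((k + 2 : ℕ) : ℂ) := by
        field_simp at hg
        push_cast at hg ⊢
        refine mul_left_cancel₀ (Nat.cast_add_one_ne_zero α : (α : ℂ) + 1 ≠ 0) ?_
        linear_combination hg
      exact_mod_cast this
    have h0 := hd _ hg'.ge
    rw [Polynomial.coeff_natDegree, Polynomial.leadingCoeff_eq_zero] at h0
    rw [h0] at hg'
    simp at hg'
  have hx0 : x = 0 := by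
    have h1 := constantCoeff_ev_eq (γ := weight (α + 1 : ℕ) k (α + 1))
      (η := weight (α + 1 : ℕ) (k + 1) 0) (by rw [sum_weight, sum_weight]; push_cast; ring) φ
    rw [← hf, hfx, h] at h1
    simpa using h1
  rw [Vanishes, ← hf, hfx, hx0, C_0]

theorem vanishes_mul_succ {α k : ℕ} (i : ℕ) {φ : MvPolynomial ℕ ℂ}
    (h : Vanishes (α + 1 : ℕ) (k + 1) ((α + 1) * i) φ)
    (hd : DegreeLT (α + 1 : ℕ) k ((α + 1) * i + α) (k + i + 2) φ) :
    Vanishes (α + 1 : ℕ) k ((α + 1) * i + α + 1) φ := by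
  induction i generalizing φ with
  | zero =>
    rw [Nat.mul_zero, Nat.zero_add] at hd
    simpa using vanishes_of_vanishes_zero h hd
  | succ i ih =>
    have hi : (α + 1) * (i + 1) = (α + 1) * i + α + 1 := by ring
    rw [hi] at h hd ⊢
    set n := (α + 1) * i
    have key : ∀ j r, j + r = α + 1 →
        Vanishes (α + 1 : ℕ) k (n + α + 1 + j) ((part 1 (k + i + 2))^[r] φ) := by
      intro j
      induction j with
      | zero =>
        intro r hr
        obtain rfl : r = α + 1 := by omega
        exact h.iterate_of_degreeLT hd
      | succ j ihj =>
        intro r hr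
        rw [show n + α + 1 + (j + 1) = n + α + (j + 1) + 1 by ring]
        refine vanishes_extend (fun φ => ih) ?_ fun t ht => ?_
        · refine Vanishes.iterate ?_
          rwa [show n + (j + 1) + r = n + α + 1 by omega]
        · rcases ht.eq_or_lt with rfl | ht
          · have := ihj (r + 1) (by omega)
            rw [Function.iterate_succ_apply'] at this
            rwa [show n + α + (j + 1) = n + α + 1 + j by ring]
          · rw [part_iterate_comm]
            refine Vanishes.iterate ?_
            have := hd t ht
            rwa [show n + α + (j + 1) + r = n + α + 1 + α by omega]
    exact key (α + 1) 0 rfl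

/-- Descent from `b` variables of weight `a` to `a * b` variables of weight `1`. -/
theorem vanishes_descent {α b : ℕ} {φ : MvPolynomial ℕ ℂ} (h : Vanishes (α + 1 : ℕ) b 0 φ)
    (hd : ∀ t, b < t → part 1 t φ = 0) : ∀ i k, k + i = b →
      Vanishes (α + 1 : ℕ) k ((α + 1) * i) φ
  | 0, k, hk => by
    obtain rfl : k = b := hk
    exact h
  | i + 1, k, hk => by
    rw [show (α + 1) * (i + 1) = (α + 1) * i + α + 1 by ring]
    refine vanishes_mul_succ i (vanishes_descent h hd i (k + 1) (by omega)) fun t ht => ?_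
    rw [hd t (by omega)]
    exact .zero

section Newton

variable {B : Type*} [CommRing B]

/-- Newton's relation between power sums `p` and the generating function `F` of the elementary
symmetric functions. -/
def NewtonRel (p : ℕ → B) (F : PowerSeries B) : Prop :=
  PowerSeries.coeff 0 F = 1 ∧
    PowerSeries.derivative B F = PowerSeries.mk (fun i => (-1) ^ i * p (i + 1)) * F

theorem NewtonRel.one : NewtonRel (0 : ℕ → B) 1 := by
  refine ⟨by simp, ?_⟩
  rw [PowerSeries.derivative_one]
  ext
  simp [PowerSeries.coeff_mk]

theorem NewtonRel.mul {p q : ℕ → B} {F G : PowerSeries B} (hF : NewtonRel p F)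
    (hG : NewtonRel q G) : NewtonRel (p + q) (F * G) := by
  refine ⟨?_, ?_⟩
  · have h1 := hF.1
    have h2 := hG.1
    rw [PowerSeries.coeff_zero_eq_constantCoeff_apply] at h1 h2 ⊢
    rw [map_mul, h1, h2, mul_one]
  · have : PowerSeries.mk (fun i => (-1) ^ i * (p + q) (i + 1)) =
        PowerSeries.mk (fun i => (-1) ^ i * p (i + 1)) +
          PowerSeries.mk fun i => (-1) ^ i * q (i + 1) := by
      ext i
      simp [mul_add]
    rw [Derivation.leibniz, hF.2, hG.2, this, smul_eq_mul, smul_eq_mul]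
    ring

theorem NewtonRel.linear (x : B) :
    NewtonRel (fun r => x ^ r) (1 + PowerSeries.C x * PowerSeries.X) := by
  refine ⟨by simp, ?_⟩
  ext n
  rw [PowerSeries.coeff_derivative, map_add, PowerSeries.coeff_C_mul,
    mul_add (PowerSeries.mk _), mul_one, mul_left_comm (PowerSeries.mk _), map_add,
    PowerSeries.coeff_C_mul, PowerSeries.coeff_mk]
  cases n with
  | zero => simp
  | succ n =>
    rw [PowerSeries.coeff_succ_mul_X, PowerSeries.coeff_mk, PowerSeries.coeff_X,
      if_neg (by omega), PowerSeries.coeff_one, if_neg (by omega)]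
    ring

theorem NewtonRel.pow {p : ℕ → B} {F : PowerSeries B} (hF : NewtonRel p F) (n : ℕ) :
    NewtonRel (fun r => n * p r) (F ^ n) := by
  induction n with
  | zero =>
    convert NewtonRel.one (B := B) using 1
    · funext r
      simp
    · rw [pow_zero]
  | succ n ih =>
    rw [pow_succ]
    convert ih.mul hF using 1
    funext r
    simp [add_mul]

theorem NewtonRel.prod {ι : Type*} (s : Finset ι) {p : ι → ℕ → B} {F : ι → PowerSeries B}
    (h : ∀ i, NewtonRel (p i) (F i)) : NewtonRel (fun r => ∑ i ∈ s, p i r) (∏ i ∈ s, F i) := by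
  classical
  induction s using Finset.induction_on with
  | empty => exact NewtonRel.one
  | insert i s hi ih =>
    rw [Finset.prod_insert hi]
    convert (h i).mul ih using 1
    funext r
    simp [Finset.sum_insert hi]

theorem newtonRel_iff {p : ℕ → B} {F : PowerSeries B} : NewtonRel p F ↔
    PowerSeries.coeff 0 F = 1 ∧ ∀ j : ℕ, PowerSeries.coeff (j + 1) F * (j + 1) =
      ∑ i ∈ Finset.range (j + 1), (-1) ^ i * p (i + 1) * PowerSeries.coeff (j - i) F := by
  refine and_congr_right fun _ => ?_
  rw [PowerSeries.ext_iff]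
  refine forall_congr' fun j => ?_
  rw [PowerSeries.coeff_derivative, PowerSeries.coeff_mul,
    Finset.Nat.sum_antidiagonal_eq_sum_range_succ_mk]
  simp [PowerSeries.coeff_mk]

end Newton

/-- The elementary symmetric functions in terms of power sums. -/
noncomputable def elem : ℕ → MvPolynomial ℕ ℂ
  | 0 => 1
  | j + 1 => C ((j : ℂ) + 1)⁻¹ *
      ∑ i : Fin (j + 1), (-1) ^ (i : ℕ) * X ((i : ℕ) + 1) * elem (j - i)
decreasing_by omega

theorem elem_succ_mul (j : ℕ) : elem (j + 1) * ((j : MvPolynomial ℕ ℂ) + 1) =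
    ∑ i ∈ Finset.range (j + 1), (-1) ^ i * X (i + 1) * elem (j - i) := by
  have : (C ((j : ℂ) + 1)⁻¹ * ((j : MvPolynomial ℕ ℂ) + 1) : MvPolynomial ℕ ℂ) = 1 := by
    rw [← map_natCast C, ← C_1, ← C_add, ← C_mul, inv_mul_cancel₀ (Nat.cast_add_one_ne_zero j)]
  rw [elem, Fin.sum_univ_eq_sum_range (fun i => (-1) ^ i * X (i + 1) * elem (j - i)), mul_right_comm,
    this, one_mul]

theorem newtonRel_elem : NewtonRel X (PowerSeries.mk elem) := by
  rw [newtonRel_iff]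
  simp only [PowerSeries.coeff_mk]
  exact ⟨by rw [elem], elem_succ_mul⟩

theorem NewtonRel.coeff_eq {B : Type*} [CommRing B] [Algebra ℂ B] {p : ℕ → B} {F : PowerSeries B}
    (h : NewtonRel p F) (j : ℕ) : PowerSeries.coeff j F = aeval p (elem j) := by
  rw [newtonRel_iff] at h
  induction j using Nat.strong_induction_on with
  | _ j ih =>
  cases j with
  | zero => rw [h.1, elem, map_one]
  | succ j =>
    have hu : IsUnit ((j : B) + 1) := by
      have := (IsUnit.mk0 ((j : ℂ) + 1) (Nat.cast_add_one_ne_zero j)).map (algebraMap ℂ B)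
      simpa using this
    refine hu.mul_left_injective ?_
    dsimp only
    have h2 := congrArg (aeval p) (elem_succ_mul j)
    rw [map_mul, map_add, map_natCast, map_one, map_sum] at h2
    rw [h.2, h2]
    refine Finset.sum_congr rfl fun i _ => ?_
    rw [ih _ (by omega)]
    simp

theorem natDegree_split_elem_le (j : ℕ) : (split 1 (elem j)).natDegree ≤ 1 := by
  have h1 : NewtonRel (fun r => Polynomial.C (X r))
      (PowerSeries.map (Polynomial.C : _ →+* Polynomial (MvPolynomial ℕ ℂ))
        (PowerSeries.mk elem)) := by
    have := newtonRel_iff.1 newtonRel_elem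
    rw [newtonRel_iff]
    simp only [PowerSeries.coeff_map, this.1, map_one, true_and]
    intro i
    have := congrArg (Polynomial.C : _ →+* Polynomial (MvPolynomial ℕ ℂ)) (this.2 i)
    simpa using this
  have h2 := (h1.mul (NewtonRel.linear Polynomial.X)).coeff_eq j
  have h3 : aeval ((fun r => Polynomial.C (X r)) + fun r => Polynomial.X ^ r) (elem j) =
      split 1 (elem j) := by
    rw [split]
    congr 2
    funext r
    simp
  rw [← h3, ← h2, mul_add, mul_one, map_add, mul_left_comm, PowerSeries.coeff_C_mul]
  refine (Polynomial.natDegree_add_le _ _).trans (max_le (by simp) ?_)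
  cases j with
  | zero => simp
  | succ j =>
    rw [PowerSeries.coeff_succ_mul_X, PowerSeries.coeff_map]
    exact Polynomial.natDegree_mul_le.trans (by simp)

theorem degree_eq_of_mem_support {σ R : Type*} [CommSemiring R] {P : MvPolynomial σ R} {k : ℕ}
    (hP : P.IsHomogeneous k) {d : σ →₀ ℕ} (hd : d ∈ P.support) : d.degree = k := by
  by_contra h
  exact mem_support_iff.1 hd (hP.coeff_eq_zero h)

theorem natDegree_aeval_le {σ R : Type*} [CommRing R] [Algebra ℂ R] {g : σ → Polynomial R}
    (hg : ∀ i, (g i).natDegree ≤ 1) {k : ℕ} {P : MvPolynomial σ ℂ} (hP : P.IsHomogeneous k) :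
    (aeval g P).natDegree ≤ k := by
  rw [aeval_def, eval₂_eq]
  refine Polynomial.natDegree_sum_le_of_forall_le _ _ fun d hd => ?_
  rw [Polynomial.algebraMap_apply]
  refine (Polynomial.natDegree_C_mul_le _ _).trans ?_
  refine (Polynomial.natDegree_prod_le _ _).trans ?_
  rw [← degree_eq_of_mem_support hP hd, Finsupp.degree_apply]
  refine Finset.sum_le_sum fun i _ => ?_
  refine Polynomial.natDegree_pow_le.trans ?_
  simpa using Nat.mul_le_mul_left (d i) (hg i)

/-- The generating polynomial of the elementary symmetric polynomials. -/
noncomputable def esymmPoly (n : ℕ) : Polynomial (MvPolynomial (Fin n) ℂ) :=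
  ∏ i, (1 + Polynomial.C (X i) * Polynomial.X)

theorem ev_const_elem {n : ℕ} (a j : ℕ) :
    ev (fun _ : Fin n => (a : ℂ)) (elem j) = (esymmPoly n ^ a).coeff j := by
  have h := NewtonRel.coeff_eq (NewtonRel.prod Finset.univ
    fun i : Fin n => (NewtonRel.linear (X i : MvPolynomial (Fin n) ℂ)).pow a) j
  rw [ev, ← Polynomial.coeff_coe, esymmPoly]
  refine Eq.trans ?_ (h.symm.trans ?_)
  · simp
  · rw [Finset.prod_pow, Polynomial.coe_pow]
    congr 2
    rw [← Polynomial.coeToPowerSeries.ringHom_apply, map_prod]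
    simp

theorem coeff_esymmPoly (n j : ℕ) : (esymmPoly n).coeff j = esymm (Fin n) ℂ j := by
  rw [esymmPoly, Finset.prod_one_add, Polynomial.finsetSum_coeff, esymm,
    Finset.powersetCard_eq_filter, Finset.sum_filter]
  refine Finset.sum_congr rfl fun s _ => ?_
  rw [Finset.prod_mul_distrib, Finset.prod_const, ← map_prod, Polynomial.coeff_C_mul,
    Polynomial.coeff_X_pow]
  simp [eq_comm]

theorem natDegree_esymmPoly_le (n : ℕ) : (esymmPoly n).natDegree ≤ n := by
  refine (Polynomial.natDegree_prod_le _ _).trans ?_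
  refine (Finset.sum_le_card_nsmul _ _ 1 fun i _ => ?_).trans (by simp)
  compute_degree

theorem coeff_aeval_of_isHomogeneous {R : Type*} [CommRing R] {N : ℕ} {Q : MvPolynomial (Fin 2) R}
    (hQ : Q.IsHomogeneous N) {j : ℕ} (hj : j ≤ N) :
    (aeval ![Polynomial.X, 1] Q : Polynomial R).coeff j =
      coeff (Finsupp.single 0 j + Finsupp.single 1 (N - j)) Q := by
  have h1 (d : Fin 2 →₀ ℕ) : (Polynomial.C (coeff d Q) * ∏ i, ![Polynomial.X, 1] i ^ d i :
      Polynomial R).coeff j = if d 0 = j then coeff d Q else 0 := by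
    simp [Fin.prod_univ_two, Polynomial.coeff_X_pow, eq_comm]
  rw [aeval_def, eval₂_eq', Polynomial.finsetSum_coeff]
  simp only [Polynomial.algebraMap_apply, Algebra.algebraMap_self, RingHom.id_apply, h1]
  rw [Finset.sum_eq_single (Finsupp.single 0 j + Finsupp.single 1 (N - j))]
  · simp
  · intro d hd hne
    refine if_neg fun h0 => hne ?_
    have := degree_eq_of_mem_support hQ hd
    rw [Finsupp.degree_eq_sum, Fin.sum_univ_two] at this
    ext i
    fin_cases i
    · simpa using h0
    · simp
      omega
  · intro h
    rw [notMem_support_iff.1 h, ite_self]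

theorem weight_zero_left (a : ℂ) : ∀ p : ℕ, weight a 0 p = fun _ => 1
  | 0 => funext fun i => (Fin.isEmpty.false i).elim
  | p + 1 => by rw [weight, weight_zero_left a p]; exact (const_eq_cons (n := 0 + p) 1).symm

theorem isHomogeneous_genForm (b : ℕ) : (genForm b).IsHomogeneous b := by
  refine IsHomogeneous.sum _ _ _ fun i _ => ?_
  have := ((isHomogeneous_C (Fin 2) (X i : MvPolynomial (Fin (b + 1)) ℂ)).mul
    ((isHomogeneous_X _ (0 : Fin 2)).pow (i : ℕ))).mul
    ((isHomogeneous_X _ (1 : Fin 2)).pow (b - (i : ℕ)))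
  have h : 0 + 1 * (i : ℕ) + 1 * (b - (i : ℕ)) = b := by omega
  rwa [h] at this

theorem coeffC_eq (a b : ℕ) {j : ℕ} (hj : j ≤ a * b) : coeffC a b j =
    ((∑ i : Fin (b + 1), Polynomial.C (X i : MvPolynomial (Fin (b + 1)) ℂ) *
      Polynomial.X ^ (i : ℕ)) ^ a).coeff j := by
  have h : (genForm b ^ a).IsHomogeneous (a * b) := mul_comm b a ▸ (isHomogeneous_genForm b).pow a
  rw [coeffC, ← coeff_aeval_of_isHomogeneous h hj, map_pow, genForm, map_sum]
  simp

/-- Specialisation of the generic form to a product of linear forms. -/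
noncomputable def linearFactors (b : ℕ) :
    MvPolynomial (Fin (b + 1)) ℂ →ₐ[ℂ] MvPolynomial (Fin b) ℂ :=
  aeval fun i => (esymmPoly b).coeff i

theorem linearFactors_coeffC (a b : ℕ) {j : ℕ} (hj : j ≤ a * b) :
    linearFactors b (coeffC a b j) = (esymmPoly b ^ a).coeff j := by
  rw [coeffC_eq a b hj]
  have h := Polynomial.coeff_map (p := (∑ i : Fin (b + 1),
    Polynomial.C (X i : MvPolynomial (Fin (b + 1)) ℂ) * Polynomial.X ^ (i : ℕ)) ^ a)
    (linearFactors b : _ →+* MvPolynomial (Fin b) ℂ) j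
  refine h.symm.trans ?_
  congr 1
  rw [Polynomial.map_pow]
  congr 1
  rw [Polynomial.map_sum, Polynomial.as_sum_range' (esymmPoly b) (b + 1)
    (Nat.lt_succ_of_le (natDegree_esymmPoly_le b)), ← Fin.sum_univ_eq_sum_range
      (fun i => Polynomial.monomial i ((esymmPoly b).coeff i))]
  refine Finset.sum_congr rfl fun i _ => ?_
  simp [linearFactors, ← Polynomial.C_mul_X_pow_eq_monomial]

theorem subst_one_eq_sum {n : ℕ} (P : MvPolynomial (Fin (n + 1)) ℂ) :
    subst 1 P = ∑ d ∈ P.support, monomial d.tail (coeff d P) := by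
  rw [subst, aeval_def, eval₂_eq']
  refine Finset.sum_congr rfl fun d _ => ?_
  rw [Fin.prod_univ_succ, monomial_eq, Finsupp.prod_fintype _ _ (by simp)]
  simp [Finsupp.tail_apply]

theorem eq_zero_of_subst_one_eq_zero {n k : ℕ} {P : MvPolynomial (Fin (n + 1)) ℂ}
    (hP : P.IsHomogeneous k) (h : subst 1 P = 0) : P = 0 := by
  classical
  ext d
  rw [coeff_zero]
  by_contra hd
  have hd' := mem_support_iff.2 hd
  refine hd ?_
  have h2 := congrArg (coeff d.tail) h
  rw [subst_one_eq_sum, coeff_sum, Finset.sum_eq_single_of_mem d hd'] at h2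
  · simpa using h2
  · intro e he hne
    rw [coeff_monomial, if_neg]
    intro htail
    refine hne ?_
    have h0 := (degree_eq_of_mem_support hP he).trans (degree_eq_of_mem_support hP hd').symm
    rw [Finsupp.degree_eq_sum, Finsupp.degree_eq_sum, Fin.sum_univ_succ, Fin.sum_univ_succ] at h0
    have h1 (i : Fin n) : e i.succ = d i.succ := DFunLike.congr_fun htail i
    simp only [h1, add_left_inj] at h0
    ext i
    exact Fin.cases h0 h1 i

theorem eq_zero_of_aeval_esymm_eq_zero {n m k : ℕ} (hm : n ≤ m) {P : MvPolynomial (Fin (n + 1)) ℂ}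
    (hP : P.IsHomogeneous k) (h : aeval (fun j : Fin (n + 1) => esymm (Fin m) ℂ j) P = 0) :
    P = 0 := by
  refine eq_zero_of_subst_one_eq_zero hP ?_
  refine esymmAlgHom_injective (σ := Fin m) ℂ (n := n) (by simpa using hm) ?_
  rw [map_zero]
  refine Subtype.ext ?_
  rw [esymmAlgHom_apply, ZeroMemClass.coe_zero, ← h]
  refine AlgHom.congr_fun (φ₁ := (aeval fun i : Fin n => esymm (Fin m) ℂ (i + 1)).comp (subst 1))
    ?_ P
  ext j : 1
  refine Fin.cases ?_ (fun i => ?_) j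
  · simp
  · simp

end FoulkesHowe

/-- For `k ≤ b`, the Foulkes–Howe map is injective in degree `k`. -/
theorem foulkesHowe_injective_low_degree (a b : ℕ) (ha : 1 ≤ a) (hb : 1 ≤ b)
    (k : ℕ) (hk : k ≤ b) (P : MvPolynomial (Fin (a * b + 1)) ℂ)
    (hP : P.IsHomogeneous k) (h : FH a b P = 0) : P = 0 := by
  open FoulkesHowe in
  obtain ⟨α, rfl⟩ : ∃ α, a = α + 1 := ⟨a - 1, by omega⟩
  have hev {m : ℕ} (γ : Fin m → ℂ) : ev γ (aeval (fun j : Fin ((α + 1) * b + 1) => elem j) P) =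
      aeval (fun j : Fin ((α + 1) * b + 1) => ev γ (elem j)) P :=
    comp_aeval_apply _ _ _
  have hφ : Vanishes (α + 1 : ℕ) b 0
      (aeval (fun j : Fin ((α + 1) * b + 1) => elem j) P) := by
    have h1 := congrArg (linearFactors b) h
    rw [FH, comp_aeval_apply, map_zero] at h1
    rw [Vanishes, hev, ← h1]
    congr 2
    funext j
    rw [linearFactors_coeffC _ _ (Nat.lt_succ_iff.1 j.2)]
    exact ev_const_elem (n := b) _ _
  have hd (t : ℕ) (ht : b < t) :
      part 1 t (aeval (fun j : Fin ((α + 1) * b + 1) => elem j) P) = 0 := by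
    refine Polynomial.coeff_eq_zero_of_natDegree_lt (lt_of_le_of_lt ?_ ht)
    rw [comp_aeval_apply]
    exact (natDegree_aeval_le (fun j => natDegree_split_elem_le _) hP).trans hk
  have h3 := vanishes_descent hφ hd b 0 (zero_add b)
  rw [Vanishes, weight_zero_left, hev] at h3
  refine eq_zero_of_aeval_esymm_eq_zero (m := 0 + (α + 1) * b) (by simp) hP ?_
  rw [← h3]
  congr 2
  funext j
  have := ev_const_elem (n := 0 + (α + 1) * b) 1 j
  rw [pow_one, coeff_esymmPoly, Nat.cast_one] at this
  exact this.symm
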